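/- Let q₁ < q₂ < ⋯ < q_{n−1} be real numbers, and let α_i, β_i ∈ ℝ (i = 1,…,n−1) satisfy α_i ≤ 1/2 for all i, Σ_{i=1}^{n−1} β_i = 0, and Σ_{i=1}^{n−1} (α_i + q_i β_i) ≤ 1/2. Set Q(z) = Σ_{i=1}^{n−1} ( α_i/(z − q_i)² + β_i/(z − q_i) ). Then there exists a solution v ∈ C²(closure(ℝ²₊) \ {q₁,…,q_{n−1}}) of problem (+s) with K = 1 (for some boundary constants c_j ∈ ℝ) such that ∫_{ℝ²₊} e^v < ∞ and the Schwarzian map of v equals Q. -/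

import Mathlib

open Complex Set Filter MeasureTheory

/-- The Laplacian Δv = v_ss + v_tt of a function v : ℂ → ℝ, identifying ℂ ≅ ℝ². -/
noncomputable def lap (v : ℂ → ℝ) (z : ℂ) : ℝ :=
  fderiv ℝ (fun w => fderiv ℝ v w 1) z 1 +
  fderiv ℝ (fun w => fderiv ℝ v w Complex.I) z Complex.I

/-- The boundary derivative ∂v/∂t at a real point s, taken within the closed upper
half-plane. -/
noncomputable def dnu (v : ℂ → ℝ) (s : ℝ) : ℝ :=
  fderivWithin ℝ v {w : ℂ | 0 ≤ w.im} (s : ℂ) Complex.I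

/-- v_z = (v_s − i v_t)/2, with derivatives taken within the closed upper half-plane. -/
noncomputable def vzc (v : ℂ → ℝ) (z : ℂ) : ℂ :=
  (((fderivWithin ℝ v {w : ℂ | 0 ≤ w.im} z 1 : ℝ) : ℂ)
    - Complex.I * ((fderivWithin ℝ v {w : ℂ | 0 ≤ w.im} z Complex.I : ℝ) : ℂ)) / 2

/-- The Schwarzian map Q = v_zz − (1/2) v_z² of a solution v of the Liouville equation. -/
noncomputable def schwarzianMap (v : ℂ → ℝ) (z : ℂ) : ℂ :=
  (fderivWithin ℝ (vzc v) {w : ℂ | 0 ≤ w.im} z 1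
    - Complex.I * fderivWithin ℝ (vzc v) {w : ℂ | 0 ≤ w.im} z Complex.I) / 2
  - (vzc v z) ^ 2 / 2

/-- Problem (+s): v ∈ C²(closure(ℝ²₊) \ {q₁,…,q_m}) with Δv + 2K e^v = 0 in ℝ²₊ and
∂v/∂t = c_j e^{v/2} on each boundary interval I_j = (q_j, q_{j+1}) (where
q₀ = −∞, q_{m+1} = +∞); the interval membership is encoded via the order relations
with the boundary singularities. -/
def IsSolutionPS (K : ℝ) (m : ℕ) (q : Fin m → ℝ) (c : Fin (m + 1) → ℝ)
    (v : ℂ → ℝ) : Prop :=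
  ContDiffOn ℝ 2 v ({z : ℂ | 0 ≤ z.im} \ (Set.range fun i => (q i : ℂ))) ∧
  (∀ z : ℂ, 0 < z.im → lap v z + 2 * K * Real.exp (v z) = 0) ∧
  (∀ j : Fin (m + 1), ∀ s : ℝ,
    (∀ i : Fin m, ((i : ℕ) < (j : ℕ) → q i < s) ∧ ((j : ℕ) ≤ (i : ℕ) → s < q i)) →
    dnu v s = c j * Real.exp (v (s : ℂ) / 2))




/-- radial primitive -/
noncomputable def radPrim (z0 : ℂ) (f : ℂ → ℂ) (z : ℂ) : ℂ :=
  ∫ s in (0:ℝ)..1, (z - z0) * f (z0 + (s:ℂ) * (z - z0))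

/-- radially closed set about `z0` -/
def RadStar (z0 : ℂ) (D : Set ℂ) : Prop :=
  ∀ z ∈ D, ∀ s ∈ Icc (0:ℝ) 1, z0 + (s:ℂ) * (z - z0) ∈ D

theorem radHull {z0 : ℂ} {D : Set ℂ} (hD : IsOpen D) (hs : RadStar z0 D) {z : ℂ} (hz : z ∈ D) :
    ∃ r > 0, ∃ K ⊆ D, IsCompact K ∧ RadStar z0 K ∧ Metric.ball z r ⊆ K := by
  obtain ⟨r, hr, hrD⟩ := Metric.nhds_basis_closedBall.mem_iff.1 (hD.mem_nhds hz)
  refine ⟨r, hr, (fun p : ℝ × ℂ => z0 + (p.1:ℂ) * (p.2 - z0)) '' (Icc 0 1 ×ˢ Metric.closedBall z r),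
    ?_, ?_, ?_, ?_⟩
  · rintro _ ⟨⟨s, w⟩, ⟨h1, h2⟩, rfl⟩
    exact hs w (hrD h2) s h1
  · apply (isCompact_Icc.prod (isCompact_closedBall z r)).image
    fun_prop
  · rintro _ ⟨⟨s, w⟩, ⟨h1, h2⟩, rfl⟩ t ht
    refine ⟨⟨t * s, w⟩, ⟨⟨mul_nonneg ht.1 h1.1, mul_le_one₀ ht.2 h1.1 h1.2⟩, h2⟩, ?_⟩
    push_cast; ring
  · intro w hw
    exact ⟨⟨1, w⟩, ⟨⟨zero_le_one, le_rfl⟩, Metric.ball_subset_closedBall hw⟩, by simp⟩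

theorem radPrim_hasDerivAt {z0 : ℂ} {D : Set ℂ} (hD : IsOpen D) (hs : RadStar z0 D)
    {f : ℂ → ℂ} (hf : DifferentiableOn ℂ f D) {z : ℂ} (hz : z ∈ D) :
    HasDerivAt (radPrim z0 f) (f z) z := by
  obtain ⟨r, hr, K, hKD, hK, hKs, hbK⟩ := radHull hD hs hz
  have hf' : DifferentiableOn ℂ (deriv f) D := hf.deriv hD
  have hda : ∀ w ∈ D, HasDerivAt f (deriv f w) w := fun w hw =>
    (hf.differentiableAt (hD.mem_nhds hw)).hasDerivAt
  obtain ⟨M0, hM0⟩ := hK.exists_bound_of_continuousOn (hf.continuousOn.mono hKD)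
  obtain ⟨M1, hM1⟩ := hK.exists_bound_of_continuousOn (hf'.continuousOn.mono hKD)
  obtain ⟨M2, hM2⟩ := hK.exists_bound_of_continuousOn (f := fun w => w - z0) (by fun_prop)
  have hline : ∀ w : ℂ, Continuous fun s : ℝ => z0 + (s:ℂ) * (w - z0) := fun w => by fun_prop
  have hIcc : ∀ s ∈ uIoc (0:ℝ) 1, s ∈ Icc (0:ℝ) 1 := fun s hs => by
    rw [uIoc_of_le zero_le_one] at hs; exact ⟨hs.1.le, hs.2⟩
  have hcF : ∀ w ∈ D, ContinuousOn (fun s : ℝ => f (z0 + (s:ℂ) * (w - z0))) (Icc 0 1) := fun w hw =>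
    hf.continuousOn.comp (hline w).continuousOn (fun s h => hs w hw s h)
  have hcF' : ∀ w ∈ D, ContinuousOn (fun s : ℝ => deriv f (z0 + (s:ℂ) * (w - z0))) (Icc 0 1) := fun w hw =>
    hf'.continuousOn.comp (hline w).continuousOn (fun s h => hs w hw s h)
  have hbD : ∀ w ∈ Metric.ball z r, w ∈ D := fun w hw => hKD (hbK hw)
  have key := intervalIntegral.hasDerivAt_integral_of_dominated_loc_of_deriv_le
    (μ := volume) (a := 0) (b := 1)
    (F := fun w (s:ℝ) => (w - z0) * f (z0 + (s:ℂ) * (w - z0)))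
    (F' := fun w (s:ℝ) => f (z0 + (s:ℂ) * (w - z0)) + (w - z0) * (deriv f (z0 + (s:ℂ) * (w - z0)) * s))
    (bound := fun _ => M0 + M2 * M1) (x₀ := z) (Metric.ball_mem_nhds z hr) ?_ ?_ ?_ ?_ ?_ ?_
  · have e : ∫ s in (0:ℝ)..1, (f (z0 + (s:ℂ) * (z - z0)) + (z - z0) * (deriv f (z0 + (s:ℂ) * (z - z0)) * s))
        = f z := by
      have := intervalIntegral.integral_eq_sub_of_hasDerivAt (a := 0) (b := 1)
        (f := fun s : ℝ => (s:ℂ) * f (z0 + (s:ℂ) * (z - z0)))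
        (f' := fun s : ℝ => f (z0 + (s:ℂ) * (z - z0)) + (z - z0) * (deriv f (z0 + (s:ℂ) * (z - z0)) * s))
        ?_ key.1
      · rw [this]; simp
      · intro s hs'
        rw [uIcc_of_le zero_le_one] at hs'
        have h1 : HasDerivAt (fun s : ℝ => (s:ℂ)) 1 s := Complex.ofRealCLM.hasDerivAt
        have h2 : HasDerivAt (fun s : ℝ => z0 + (s:ℂ) * (z - z0)) (1 * (z - z0)) s :=
          (h1.mul_const _).const_add _
        have h3 := (hda _ (hs z hz s hs')).comp_of_eq s h2 rfl
        have h4 := h1.mul h3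
        refine h4.congr_deriv ?_
        simp only [Function.comp]; ring
    rw [← e]; exact key.2
  · filter_upwards [Metric.ball_mem_nhds z hr] with w hw
    refine ContinuousOn.aestronglyMeasurable ?_ measurableSet_uIoc
    exact (continuousOn_const.mul (hcF w (hbD w hw))).mono hIcc
  · apply ContinuousOn.intervalIntegrable
    rw [uIcc_of_le zero_le_one]
    exact continuousOn_const.mul (hcF z hz)
  · refine ContinuousOn.aestronglyMeasurable ?_ measurableSet_uIoc
    refine ContinuousOn.mono ?_ hIcc
    exact (hcF z hz).add (continuousOn_const.mul ((hcF' z hz).mul (by fun_prop)))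
  · refine Eventually.of_forall fun s hs' w hw => ?_
    have hmem := hKs w (hbK hw) s (hIcc s hs')
    have h0 := hM0 _ hmem
    have h1 := hM1 _ hmem
    have h2 := hM2 _ (hbK hw)
    have h3 : ‖(s:ℂ)‖ ≤ 1 := by
      rw [Complex.norm_real, Real.norm_eq_abs, abs_le]
      have := hIcc s hs'; constructor <;> linarith [this.1, this.2]
    refine (norm_add_le _ _).trans (add_le_add h0 ?_)
    rw [norm_mul, norm_mul]
    refine mul_le_mul h2 ?_ (by positivity) ((norm_nonneg _).trans h2)
    calc _ ≤ M1 * 1 := mul_le_mul h1 h3 (norm_nonneg _) ((norm_nonneg _).trans h1)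
      _ = M1 := mul_one _
  · exact intervalIntegrable_const
  · refine Eventually.of_forall fun s hs' w hw => ?_
    have h1 : HasDerivAt (fun w : ℂ => w - z0) 1 w := (hasDerivAt_id w).sub_const z0
    have h2 : HasDerivAt (fun w : ℂ => z0 + (s:ℂ) * (w - z0)) ((s:ℂ) * 1) w :=
      (h1.const_mul _).const_add _
    have h3 := (hda _ (hs w (hbD w hw) s (hIcc s hs'))).comp w h2
    have h4 := h1.mul h3
    refine h4.congr_deriv ?_
    simp only [Function.comp]; ring

theorem radPrim_self (z0 : ℂ) (f : ℂ → ℂ) : radPrim z0 f z0 = 0 := by simp [radPrim]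

theorem radPrim_bound {z0 : ℂ} {K : Set ℂ} (hs : RadStar z0 K) {f : ℂ → ℂ} {B : ℝ} {n : ℕ}
    (hf : ∀ z ∈ K, ‖f z‖ ≤ B * ‖z - z0‖ ^ n) {z : ℂ} (hz : z ∈ K) :
    ‖radPrim z0 f z‖ ≤ B / (n + 1) * ‖z - z0‖ ^ (n + 1) := by
  have h := intervalIntegral.norm_integral_le_of_norm_le (μ := volume) (a := 0) (b := 1)
    (f := fun s : ℝ => (z - z0) * f (z0 + (s:ℂ) * (z - z0)))
    (g := fun s : ℝ => B * ‖z - z0‖ ^ (n + 1) * s ^ n) zero_le_one ?_ ?_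
  · refine h.trans (le_of_eq ?_)
    rw [intervalIntegral.integral_const_mul, integral_pow]
    simp; ring
  · refine Eventually.of_forall fun s hs' => ?_
    have hs'' : s ∈ Icc (0:ℝ) 1 := ⟨hs'.1.le, hs'.2⟩
    have h1 := hf _ (hs z hz s hs'')
    rw [norm_mul]
    have e : ‖z0 + (s:ℂ) * (z - z0) - z0‖ = s * ‖z - z0‖ := by
      rw [add_sub_cancel_left, norm_mul, Complex.norm_real, Real.norm_of_nonneg hs''.1]
    rw [e] at h1
    calc _ ≤ ‖z - z0‖ * (B * (s * ‖z - z0‖) ^ n) := by gcongr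
      _ = _ := by ring
  · apply Continuous.intervalIntegrable; fun_prop

/-- Picard terms -/
noncomputable def picT (z0 : ℂ) (Q : ℂ → ℂ) (a b : ℂ) : ℕ → ℂ → ℂ
  | 0 => fun z => a + b * (z - z0)
  | n + 1 => radPrim z0 (radPrim z0 (fun z => Q z * picT z0 Q a b n z))

theorem picT_diff {z0 : ℂ} {D : Set ℂ} (hD : IsOpen D) (hs : RadStar z0 D)
    {Q : ℂ → ℂ} (hQ : DifferentiableOn ℂ Q D) (a b : ℂ) (n : ℕ) :
    DifferentiableOn ℂ (picT z0 Q a b n) D := by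
  induction n with
  | zero => simp only [picT]; fun_prop
  | succ n ih =>
    have h1 : DifferentiableOn ℂ (radPrim z0 (fun z => Q z * picT z0 Q a b n z)) D := fun z hz =>
      (radPrim_hasDerivAt hD hs (hQ.mul ih) hz).differentiableAt.differentiableWithinAt
    exact fun z hz => (radPrim_hasDerivAt hD hs h1 hz).differentiableAt.differentiableWithinAt

theorem picT_deriv {z0 : ℂ} {D : Set ℂ} (hD : IsOpen D) (hs : RadStar z0 D)
    {Q : ℂ → ℂ} (hQ : DifferentiableOn ℂ Q D) (a b : ℂ) (n : ℕ) {z : ℂ} (hz : z ∈ D) :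
    HasDerivAt (picT z0 Q a b (n+1)) (radPrim z0 (fun z => Q z * picT z0 Q a b n z) z) z ∧
    HasDerivAt (radPrim z0 (fun z => Q z * picT z0 Q a b n z)) (Q z * picT z0 Q a b n z) z := by
  have h1 : DifferentiableOn ℂ (radPrim z0 (fun z => Q z * picT z0 Q a b n z)) D := fun z hz =>
      (radPrim_hasDerivAt hD hs (hQ.mul (picT_diff hD hs hQ a b n)) hz).differentiableAt.differentiableWithinAt
  exact ⟨radPrim_hasDerivAt hD hs h1 hz,
    radPrim_hasDerivAt hD hs (hQ.mul (picT_diff hD hs hQ a b n)) hz⟩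

theorem picT_bound {z0 : ℂ} {K : Set ℂ} (hs : RadStar z0 K) {Q : ℂ → ℂ} {M B : ℝ} (a b : ℂ)
    (hM : ∀ z ∈ K, ‖Q z‖ ≤ M) (hM0 : 0 ≤ M) (hB : ∀ z ∈ K, ‖a + b * (z - z0)‖ ≤ B) (hB0 : 0 ≤ B) (n : ℕ) :
    ∀ z ∈ K, ‖picT z0 Q a b n z‖ ≤ B * M ^ n / n.factorial * ‖z - z0‖ ^ (2 * n) := by
  induction n with
  | zero => intro z hz; simpa [picT] using hB z hz
  | succ n ih =>
    intro z hz
    have h1 : ∀ z ∈ K, ‖Q z * picT z0 Q a b n z‖ ≤ (B * M ^ (n+1) / n.factorial) * ‖z - z0‖ ^ (2 * n) := by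
      intro z hz
      rw [norm_mul]
      calc _ ≤ M * (B * M ^ n / n.factorial * ‖z - z0‖ ^ (2 * n)) :=
            mul_le_mul (hM z hz) (ih z hz) (norm_nonneg _) hM0
        _ = _ := by ring
    have h2 := fun z (hz : z ∈ K) => radPrim_bound hs h1 hz
    have h3 := radPrim_bound hs h2 hz
    refine h3.trans ?_
    rw [show 2 * (n + 1) = 2 * n + 1 + 1 by ring]
    gcongr ?_ * _
    rw [Nat.factorial_succ]
    push_cast
    rw [div_div, div_div]
    have hn : (0:ℝ) ≤ n := by positivity
    rw [mul_comm ((n:ℝ) + 1)]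
    gcongr
    nlinarith

theorem ode_exists {z0 : ℂ} {D : Set ℂ} (hD : IsOpen D) (hz0 : z0 ∈ D) (hs : RadStar z0 D)
    {Q : ℂ → ℂ} (hQ : DifferentiableOn ℂ Q D) (a b : ℂ) :
    ∃ y y' : ℂ → ℂ, (∀ z ∈ D, HasDerivAt y (y' z) z) ∧ (∀ z ∈ D, HasDerivAt y' (Q z * y z) z) ∧
      y z0 = a ∧ y' z0 = b := by
  set T := picT z0 Q a b with hT
  set S : ℕ → ℂ → ℂ := fun N z => ∑ n ∈ Finset.range N, T n z with hS
  set y : ℂ → ℂ := fun z => ∑' n, T n z with hy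
  have hlim : TendstoLocallyUniformlyOn S y atTop D := by
    rw [tendstoLocallyUniformlyOn_iff_forall_tendsto]
    intro z hz
    obtain ⟨r, hr, K, hKD, hK, hKs, hbK⟩ := radHull hD hs hz
    obtain ⟨M, hM⟩ := hK.exists_bound_of_continuousOn (hQ.continuousOn.mono hKD)
    obtain ⟨L, hL⟩ := hK.exists_bound_of_continuousOn (f := fun w => w - z0) (by fun_prop)
    obtain ⟨B, hB⟩ := hK.exists_bound_of_continuousOn (f := fun w => a + b * (w - z0)) (by fun_prop)
    have hzK : z ∈ K := hbK (Metric.mem_ball_self hr)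
    have hM0 := (norm_nonneg _).trans (hM z hzK)
    have hL0 := (norm_nonneg _).trans (hL z hzK)
    have hB0 := (norm_nonneg _).trans (hB z hzK)
    have hU : TendstoUniformlyOn S y atTop K := by
      apply tendstoUniformlyOn_tsum_nat (u := fun n => B * ((M * L ^ 2) ^ n / n.factorial))
      · exact (Real.summable_pow_div_factorial _).mul_left _
      · intro n w hw
        refine (picT_bound hKs a b hM hM0 hB hB0 n w hw).trans ?_
        calc _ ≤ B * M ^ n / n.factorial * L ^ (2 * n) := by gcongr; exact hL w hw
          _ = _ := by rw [mul_pow, ← pow_mul]; ring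
    have := (tendstoUniformlyOn_iff_tendsto.1 (hU.mono hbK))
    refine this.mono_left ?_
    gcongr
    rw [le_principal_iff]
    exact mem_nhdsWithin_of_mem_nhds (Metric.ball_mem_nhds z hr)
  have hSd : ∀ N, DifferentiableOn ℂ (S N) D := fun N => by
    simp only [hS]
    exact DifferentiableOn.fun_sum fun n _ => picT_diff hD hs hQ a b n
  have hyd : DifferentiableOn ℂ y D := hlim.differentiableOn (Eventually.of_forall hSd) hD
  have hlim1 : TendstoLocallyUniformlyOn (deriv ∘ S) (deriv y) atTop D :=
    hlim.deriv (Eventually.of_forall hSd) hD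
  have hlim2 : TendstoLocallyUniformlyOn (deriv ∘ (deriv ∘ S)) (deriv (deriv y)) atTop D :=
    hlim1.deriv (Eventually.of_forall fun N => (hSd N).deriv hD) hD
  -- derivatives of partial sums
  set P : ℕ → ℂ → ℂ := fun N z => b + ∑ n ∈ Finset.range N, radPrim z0 (fun z => Q z * T n z) z with hP
  have hS1 : ∀ N, ∀ z ∈ D, HasDerivAt (S (N+1)) (P N z) z := by
    intro N z hz
    have e : S (N+1) = fun z => (a + b * (z - z0)) + ∑ n ∈ Finset.range N, T (n+1) z := by
      funext z; simp only [hS]; rw [Finset.sum_range_succ', add_comm]; rfl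
    rw [e]
    have h0 : HasDerivAt (fun z : ℂ => a + b * (z - z0)) b z := by
      simpa using (((hasDerivAt_id z).sub_const z0).const_mul b).const_add a
    exact h0.add (HasDerivAt.fun_sum fun n _ => (picT_deriv hD hs hQ a b n hz).1)
  have hP1 : ∀ N, ∀ z ∈ D, HasDerivAt (P N) (Q z * S N z) z := by
    intro N z hz
    simp only [hS, Finset.mul_sum]
    exact (HasDerivAt.fun_sum fun n _ => (picT_deriv hD hs hQ a b n hz).2).const_add b
  have hyy : ∀ z ∈ D, deriv (deriv y) z = Q z * y z := by
    intro z hz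
    have h1 : Tendsto (fun N => deriv (deriv (S (N+1))) z) atTop (nhds (deriv (deriv y) z)) :=
      (hlim2.tendsto_at hz).comp (tendsto_add_atTop_nat 1)
    have h2 : Tendsto (fun N => Q z * S N z) atTop (nhds (Q z * y z)) :=
      (hlim.tendsto_at hz).const_mul _
    refine tendsto_nhds_unique (h1.congr fun N => ?_) h2
    have : deriv (S (N+1)) =ᶠ[nhds z] P N := by
      filter_upwards [hD.mem_nhds hz] with w hw using (hS1 N w hw).deriv
    rw [this.deriv_eq, (hP1 N z hz).deriv]
  refine ⟨y, deriv y, fun z hz => (hyd.differentiableAt (hD.mem_nhds hz)).hasDerivAt, fun z hz => ?_, ?_, ?_⟩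
  · rw [← hyy z hz]
    exact ((hyd.deriv hD).differentiableAt (hD.mem_nhds hz)).hasDerivAt
  · refine tendsto_nhds_unique ((hlim.tendsto_at hz0).comp (tendsto_add_atTop_nat 1)) ?_
    refine tendsto_const_nhds.congr fun N => ?_
    simp only [hS, Function.comp]
    rw [Finset.sum_range_succ', Finset.sum_eq_zero (fun n _ => show T (n+1) z0 = 0 from radPrim_self z0 _)]
    simp [hT, picT]
  · refine tendsto_nhds_unique ((hlim1.tendsto_at hz0).comp (tendsto_add_atTop_nat 1)) ?_
    refine tendsto_const_nhds.congr fun N => ?_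
    simp only [Function.comp]
    rw [(hS1 N z0 hz0).deriv]
    simp [hP, radPrim_self]


theorem convex_growth (A B δ : ℝ) (hA : 0 < A) (hB : 0 ≤ B) (hδ : 0 < δ) :
    ∃ T > 0, ∀ N N1 N2 : ℝ → ℝ, (∀ τ, 0 ≤ τ → HasDerivAt N (N1 τ) τ) →
      (∀ τ, 0 ≤ τ → HasDerivAt N1 (N2 τ) τ) → (∀ τ, 0 ≤ τ → 0 < N τ) →
      (∀ τ, 0 ≤ τ → δ ≤ N2 τ * N τ) → N 0 ≤ A → -B ≤ N1 0 → ∀ τ, T ≤ τ → A * τ / T ≤ N τ := by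
  set T := 1 + 4 * A * (B + 2 * A) / δ with hT
  have hT1 : 1 ≤ T := by
    have : 0 ≤ 4 * A * (B + 2 * A) / δ := by positivity
    linarith
  have hT0 : 0 < T := by linarith
  refine ⟨T, hT0, fun N N1 N2 h1 h2 hpos hδN hA0 hB0 τ hτ => ?_⟩
  have hN2 : ∀ τ, 0 ≤ τ → 0 ≤ N2 τ := fun τ h => by
    have := hδN τ h
    by_contra hc
    push Not at hc
    nlinarith [hpos τ h]
  have hconv : ConvexOn ℝ (Ici 0) N := by
    refine convexOn_of_hasDerivWithinAt2_nonneg (f' := N1) (f'' := N2) (convex_Ici 0)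
      (fun x hx => (h1 x hx).continuousAt.continuousWithinAt) ?_ ?_ ?_
    · intro x hx; rw [interior_Ici] at hx; exact (h1 x (le_of_lt hx)).hasDerivWithinAt
    · intro x hx; rw [interior_Ici] at hx; exact (h2 x (le_of_lt hx)).hasDerivWithinAt
    · intro x hx; rw [interior_Ici] at hx; exact hN2 x (le_of_lt hx)
  have hNT : 2 * A ≤ N T := by
    by_contra hc
    push Not at hc
    have hle : ∀ x ∈ Icc 0 T, N x ≤ 2 * A := by
      intro x hx
      have := hconv.le_max_of_mem_Icc (show (0:ℝ) ∈ Ici 0 from self_mem_Ici) (show T ∈ Ici 0 from hT0.le) hx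
      refine this.trans (max_le (by linarith) hc.le)
    have hN2' : ∀ x ∈ Icc 0 T, δ / (2 * A) ≤ N2 x := by
      intro x hx
      rw [div_le_iff₀ (by positivity)]
      have := hδN x hx.1
      nlinarith [hle x hx, hN2 x hx.1]
    have hG1 : MonotoneOn (fun x => N1 x + B - δ / (2 * A) * x) (Icc 0 T) := by
      refine monotoneOn_of_hasDerivWithinAt_nonneg (convex_Icc 0 T) (f' := fun x => N2 x - δ / (2 * A)) ?_ ?_ ?_
      · intro x hx
        exact ((((h2 x hx.1).continuousAt).add continuousAt_const).sub (by fun_prop)).continuousWithinAt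
      · intro x hx; rw [interior_Icc] at hx
        have := ((h2 x hx.1.le).add_const B).sub ((hasDerivAt_id x).const_mul (δ / (2 * A)))
        simp only [mul_one] at this
        exact this.hasDerivWithinAt
      · intro x hx
        have := hN2' x (interior_subset hx)
        linarith
    have hG : MonotoneOn (fun x => N x + B * x - δ / (4 * A) * x ^ 2) (Icc 0 T) := by
      refine monotoneOn_of_hasDerivWithinAt_nonneg (convex_Icc 0 T) (f' := fun x => N1 x + B - δ / (2 * A) * x) ?_ ?_ ?_
      · intro x hx
        exact ((((h1 x hx.1).continuousAt).add (by fun_prop)).sub (by fun_prop)).continuousWithinAt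
      · intro x hx; rw [interior_Icc] at hx
        have := ((h1 x hx.1.le).add ((hasDerivAt_id x).const_mul B)).sub ((hasDerivAt_pow 2 x).const_mul (δ / (4 * A)))
        refine (this.congr_deriv ?_).hasDerivWithinAt
        simp; field_simp; ring
      · intro x hx
        have hx := interior_subset hx
        have := hG1 (left_mem_Icc.2 hT0.le) hx hx.1
        simp only [mul_zero, sub_zero] at this
        linarith
    have := hG (left_mem_Icc.2 hT0.le) (right_mem_Icc.2 hT0.le) hT0.le
    simp only [mul_zero, add_zero, ne_eq, OfNat.ofNat_ne_zero, not_false_eq_true, zero_pow, sub_zero] at this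
    have e : δ / (4 * A) * T = δ / (4 * A) + (B + 2 * A) := by rw [hT]; field_simp
    have h3 : B + 2 * A ≤ δ / (4 * A) * T := by rw [e]; linarith [show 0 < δ / (4 * A) by positivity]
    have := hpos 0 le_rfl
    nlinarith
  have hτ0 : 0 < τ := by linarith
  have hc := hconv.2 (show (0:ℝ) ∈ Ici 0 from self_mem_Ici) (show τ ∈ Ici 0 from hτ0.le)
    (show 0 ≤ 1 - T / τ by rw [sub_nonneg, div_le_one hτ0]; exact hτ) (show 0 ≤ T / τ by positivity) (by ring)
  simp only [smul_eq_mul, mul_zero, zero_add] at hc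
  rw [div_mul_cancel₀ _ hτ0.ne'] at hc
  have h4 : (1 - T / τ) * N 0 ≤ A := by
    have := hpos 0 le_rfl
    have : 0 < T / τ := by positivity
    nlinarith
  have h5 : A ≤ T / τ * N τ := by linarith
  rw [div_le_iff₀ hT0]
  rw [div_mul_eq_mul_div, le_div_iff₀ hτ0] at h5
  linarith

theorem hasDerivAt_re' {Y : ℝ → ℂ} {Z : ℂ} {t : ℝ} (h : HasDerivAt Y Z t) :
    HasDerivAt (fun t => (Y t).re) Z.re t :=
  Complex.reCLM.hasFDerivAt.comp_hasDerivAt t h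

theorem hasDerivAt_im' {Y : ℝ → ℂ} {Z : ℂ} {t : ℝ} (h : HasDerivAt Y Z t) :
    HasDerivAt (fun t => (Y t).im) Z.im t :=
  Complex.imCLM.hasFDerivAt.comp_hasDerivAt t h

theorem lagrange_aux (Y1 Y2 X1 X2 : ℂ) :
    normSq (Y1 * X2 - Y2 * X1) ≤ (normSq Y1 + normSq Y2) * (normSq X1 + normSq X2) := by
  simp only [normSq_apply, mul_re, mul_im, sub_re, sub_im]
  nlinarith [sq_nonneg (Y1.re * X1.re + Y1.im * X1.im + Y2.re * X2.re + Y2.im * X2.im),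
    sq_nonneg (Y1.re * X1.im - Y1.im * X1.re + Y2.re * X2.im - Y2.im * X2.re)]

theorem ray_growth (t0 B w : ℝ) (ht0 : 0 < t0) (hB : 0 < B) (hw : 0 < w) :
    ∃ T > 0, ∃ c > 0, ∀ Y1 Y2 Z1 Z2 k : ℝ → ℂ,
      (∀ t, t0 ≤ t → HasDerivAt Y1 (Z1 t) t) → (∀ t, t0 ≤ t → HasDerivAt Y2 (Z2 t) t) →
      (∀ t, t0 ≤ t → HasDerivAt Z1 (k t * Y1 t) t) → (∀ t, t0 ≤ t → HasDerivAt Z2 (k t * Y2 t) t) →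
      (∀ t, t0 ≤ t → -(1 / (4 * t ^ 2)) ≤ (k t).re) →
      (∀ t, t0 ≤ t → w ≤ normSq (Y1 t * Z2 t - Y2 t * Z1 t)) →
      ‖Y1 t0‖ ≤ B → ‖Y2 t0‖ ≤ B → ‖Z1 t0‖ ≤ B → ‖Z2 t0‖ ≤ B →
      ∀ t, t0 * Real.exp T ≤ t → c * t * Real.log (t / t0) ≤ normSq (Y1 t) + normSq (Y2 t) := by
  obtain ⟨T, hT, H⟩ := convex_growth (2 * B ^ 2 / t0) (4 * B ^ 2 + 2 * B ^ 2 / t0) (2 * w) (by positivity)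
    (by positivity) (by positivity)
  refine ⟨T, hT, (2 * B ^ 2 / t0) / T, by positivity, ?_⟩
  intro Y1 Y2 Z1 Z2 k hY1 hY2 hZ1 hZ2 hk hW b1 b2 b3 b4 t ht
  set M : ℝ → ℝ := fun t => normSq (Y1 t) + normSq (Y2 t) with hM
  set M1 : ℝ → ℝ := fun t => 2 * ((Y1 t).re * (Z1 t).re + (Y1 t).im * (Z1 t).im +
    ((Y2 t).re * (Z2 t).re + (Y2 t).im * (Z2 t).im)) with hM1
  set M2 : ℝ → ℝ := fun t => 2 * (normSq (Z1 t) + normSq (Z2 t)) + 2 * (k t).re * M t with hM2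
  have dM : ∀ t, t0 ≤ t → HasDerivAt M (M1 t) t := by
    intro t ht
    have a1 := hasDerivAt_re' (hY1 t ht)
    have a2 := hasDerivAt_im' (hY1 t ht)
    have a3 := hasDerivAt_re' (hY2 t ht)
    have a4 := hasDerivAt_im' (hY2 t ht)
    have := ((a1.mul a1).add (a2.mul a2)).add ((a3.mul a3).add (a4.mul a4))
    refine this.congr_deriv ?_
    simp only [hM1]; ring
  have dM1 : ∀ t, t0 ≤ t → HasDerivAt M1 (M2 t) t := by
    intro t ht
    have a1 := hasDerivAt_re' (hY1 t ht)
    have a2 := hasDerivAt_im' (hY1 t ht)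
    have a3 := hasDerivAt_re' (hY2 t ht)
    have a4 := hasDerivAt_im' (hY2 t ht)
    have c1 := hasDerivAt_re' (hZ1 t ht)
    have c2 := hasDerivAt_im' (hZ1 t ht)
    have c3 := hasDerivAt_re' (hZ2 t ht)
    have c4 := hasDerivAt_im' (hZ2 t ht)
    have := (((a1.mul c1).add (a2.mul c2)).add ((a3.mul c3).add (a4.mul c4))).const_mul 2
    refine this.congr_deriv ?_
    simp only [hM2, hM, normSq_apply, mul_re, mul_im]; ring
  set E : ℝ → ℝ := fun τ => t0 * Real.exp τ with hE
  have dE : ∀ τ, HasDerivAt E (E τ) τ := fun τ => (Real.hasDerivAt_exp τ).const_mul t0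
  have hE0 : ∀ τ, 0 < E τ := fun τ => by positivity
  have hEt : ∀ τ, 0 ≤ τ → t0 ≤ E τ := fun τ h => le_mul_of_one_le_right ht0.le (Real.one_le_exp h)
  have hMpos : ∀ t, t0 ≤ t → 0 < M t := by
    intro t ht
    have h1 := lagrange_aux (Y1 t) (Y2 t) (Z1 t) (Z2 t)
    have h2 := hW t ht
    have h3 : 0 ≤ M t := add_nonneg (normSq_nonneg _) (normSq_nonneg _)
    rcases h3.lt_or_eq with h | h
    · exact h
    · simp only [hM] at h; rw [← h] at h1; linarith
  have := H (fun τ => M (E τ) / E τ) (fun τ => M1 (E τ) - M (E τ) / E τ)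
    (fun τ => E τ * M2 (E τ) - M1 (E τ) + M (E τ) / E τ) ?_ ?_ ?_ ?_ ?_ ?_ (Real.log (t / t0)) ?_
  · have htp : 0 < t := lt_of_lt_of_le (by positivity) ht
    have e : E (Real.log (t / t0)) = t := by
      simp only [hE]; rw [Real.exp_log (by positivity)]; field_simp
    simp only [e] at this
    rw [le_div_iff₀ htp] at this
    refine le_trans (le_of_eq ?_) this
    ring
  · intro τ hτ
    have h1 := (dM _ (hEt τ hτ)).comp τ (dE τ)
    refine (h1.div (dE τ) (hE0 τ).ne').congr_deriv ?_
    have := (hE0 τ).ne'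
    simp only [Function.comp]; field_simp
  · intro τ hτ
    have h1 := (dM _ (hEt τ hτ)).comp τ (dE τ)
    have h2 := (dM1 _ (hEt τ hτ)).comp τ (dE τ)
    refine (h2.sub (h1.div (dE τ) (hE0 τ).ne')).congr_deriv ?_
    have := (hE0 τ).ne'
    simp only [Function.comp]; field_simp; ring
  · intro τ hτ; exact div_pos (hMpos _ (hEt τ hτ)) (hE0 τ)
  · intro τ hτ
    have hs := hEt τ hτ
    have hs0 := hE0 τ
    generalize E τ = s at hs hs0 ⊢
    have h1 := lagrange_aux (Y1 s) (Y2 s) (Z1 s - Y1 s / (2 * s : ℝ)) (Z2 s - Y2 s / (2 * s : ℝ))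
    have h2 := hW s hs
    have e1 : Y1 s * (Z2 s - Y2 s / (2 * s : ℝ)) - Y2 s * (Z1 s - Y1 s / (2 * s : ℝ)) = Y1 s * Z2 s - Y2 s * Z1 s := by ring
    rw [e1] at h1
    have hmp := hMpos s hs
    have h3 := hk s hs
    set X := normSq (Z1 s - Y1 s / (2 * s : ℝ)) + normSq (Z2 s - Y2 s / (2 * s : ℝ)) with hX
    have e2 : X = normSq (Z1 s) + normSq (Z2 s) - M1 s / (2 * s) + M s / (4 * s ^ 2) := by
      simp only [hX, hM1, hM, normSq_apply, sub_re, sub_im, div_ofReal_re, div_ofReal_im]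
      field_simp; ring
    have h4 : 2 * s * X ≤ s * M2 s - M1 s + M s / s := by
      have e3 : s * M2 s - M1 s + M s / s - 2 * s * X = 2 * s * M s * ((k s).re + 1 / (4 * s ^ 2)) := by
        rw [e2]; simp only [hM2]; field_simp; ring
      have : 0 ≤ 2 * s * M s * ((k s).re + 1 / (4 * s ^ 2)) :=
        mul_nonneg (by positivity) (by linarith)
      linarith
    calc 2 * w ≤ 2 * (M s * X) := by linarith
      _ = (2 * s * X) * (M s / s) := by field_simp
      _ ≤ _ := by gcongr
  · have e0 : E 0 = t0 := by simp [hE]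
    rw [e0]
    gcongr
    simp only [hM, normSq_eq_norm_sq]
    nlinarith [norm_nonneg (Y1 t0), norm_nonneg (Y2 t0)]
  · have e0 : E 0 = t0 := by simp [hE]
    simp only [e0]
    have hm : M t0 / t0 ≤ 2 * B ^ 2 / t0 := by
      gcongr
      simp only [hM, normSq_eq_norm_sq]
      nlinarith [norm_nonneg (Y1 t0), norm_nonneg (Y2 t0)]
    have hre : ∀ a b : ℂ, ‖a‖ ≤ B → ‖b‖ ≤ B → -B ^ 2 ≤ a.re * b.re + a.im * b.im := by
      intro a b ha hb
      have h1 : a.re * b.re + a.im * b.im = (a * (starRingEnd ℂ) b).re := by simp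
      rw [h1]
      have h2 := (abs_le.1 (Complex.abs_re_le_norm (a * (starRingEnd ℂ) b))).1
      rw [norm_mul, RCLike.norm_conj] at h2
      nlinarith [norm_nonneg a, norm_nonneg b]
    have r1 := hre _ _ b1 b3
    have r2 := hre _ _ b2 b4
    simp only [hM1]
    linarith
  · rw [Real.le_log_iff_exp_le (by have : 0 < t := lt_of_lt_of_le (by positivity) ht
                                   positivity), le_div_iff₀ ht0]
    linarith

theorem half_plane_growth {y1 y2 z1 z2 Q : ℂ → ℂ}
    (hy1 : ∀ z : ℂ, 0 < z.im → HasDerivAt y1 (z1 z) z)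
    (hy2 : ∀ z : ℂ, 0 < z.im → HasDerivAt y2 (z2 z) z)
    (hz1 : ∀ z : ℂ, 0 < z.im → HasDerivAt z1 (-(Q z / 2) * y1 z) z)
    (hz2 : ∀ z : ℂ, 0 < z.im → HasDerivAt z2 (-(Q z / 2) * y2 z) z)
    (hW : ∀ z : ℂ, 0 < z.im → y1 z * z2 z - y2 z * z1 z = 1)
    (A C R0 : ℝ) (hR0 : 0 < R0) (hA : A ≤ 1 / 2)
    (hQ : ∀ z : ℂ, R0 ≤ ‖z‖ → 0 < z.im → ‖Q z - A / z ^ 2‖ ≤ C / ‖z‖ ^ 3)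
    (hbd : ∀ R, R0 ≤ R → ∃ B, ∀ z : ℂ, ‖z‖ = R → 0 < z.im →
      ‖y1 z‖ ≤ B ∧ ‖y2 z‖ ≤ B ∧ ‖z1 z‖ ≤ B ∧ ‖z2 z‖ ≤ B) :
    ∃ R > 1, ∃ c > 0, ∀ z : ℂ, R ≤ ‖z‖ → 0 < z.im →
      c * ‖z‖ * Real.log ‖z‖ ≤ normSq (y1 z) + normSq (y2 z) := by
  set b := |C| with hb
  have hb0 : 0 ≤ b := abs_nonneg C
  set t0 := max R0 1 with ht0
  have ht1 : 1 ≤ t0 := le_max_right _ _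
  have htR : R0 ≤ t0 := le_max_left _ _
  obtain ⟨B, hB⟩ := hbd (t0 + b) (by linarith)
  obtain ⟨T, hT, c, hc, H⟩ := ray_growth t0 (|B| + 1) 1 (by linarith) (by positivity) one_pos
  set R := max (max (t0 * Real.exp T + b) (4 * t0 ^ 2)) (2 * b + 2) with hR
  have hR1 : t0 * Real.exp T + b ≤ R := (le_max_left _ _).trans (le_max_left _ _)
  have hR2 : 4 * t0 ^ 2 ≤ R := (le_max_right _ _).trans (le_max_left _ _)
  have hR3 : 2 * b + 2 ≤ R := le_max_right _ _
  refine ⟨R, by linarith, c / 4, by positivity, fun z hz hzi => ?_⟩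
  have hz0 : 0 < ‖z‖ := by linarith
  have hzc : (‖z‖ : ℂ) ≠ 0 := by exact_mod_cast hz0.ne'
  set e : ℂ := z / ‖z‖ with he
  have hen : ‖e‖ = 1 := by rw [he, norm_div, Complex.norm_real, norm_norm, div_self hz0.ne']
  have hei : 0 < e.im := by rw [he, div_ofReal_im]; positivity
  have he0 : e ≠ 0 := by intro h; rw [h] at hen; simp at hen
  set p : ℝ → ℂ := fun t => e * ((t + b : ℝ) : ℂ) with hp
  have hpn : ∀ t, t0 ≤ t → ‖p t‖ = t + b := fun t ht => by
    rw [hp, norm_mul, hen, one_mul, Complex.norm_real, Real.norm_of_nonneg (by linarith)]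
  have hpi : ∀ t, t0 ≤ t → 0 < (p t).im := fun t ht => by
    simp only [hp, im_mul_ofReal]
    have : 0 < t + b := by linarith
    positivity
  have dp : ∀ t, HasDerivAt p e t := fun t => by
    have h1 : HasDerivAt (fun t : ℝ => ((t + b : ℝ) : ℂ)) 1 t :=
      ((hasDerivAt_id t).add_const b).ofReal_comp
    exact (h1.const_mul e).congr_deriv (mul_one e)
  have key := H (fun t => y1 (p t)) (fun t => y2 (p t)) (fun t => e * z1 (p t)) (fun t => e * z2 (p t))
    (fun t => - e ^ 2 * (Q (p t) / 2)) ?_ ?_ ?_ ?_ ?_ ?_ ?_ ?_ ?_ ?_ (‖z‖ - b) (by linarith)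
  · have hpz : p (‖z‖ - b) = z := by
      simp only [hp, he, sub_add_cancel]; field_simp
    simp only [hpz] at key
    refine le_trans ?_ key
    have h1 : ‖z‖ / 2 ≤ ‖z‖ - b := by linarith
    have h2 : Real.log ‖z‖ / 2 ≤ Real.log ((‖z‖ - b) / t0) := by
      rw [← Real.log_sqrt hz0.le]
      apply Real.log_le_log (Real.sqrt_pos.2 hz0)
      rw [le_div_iff₀ (by linarith)]
      refine le_trans ?_ h1
      have h3 : 2 * t0 ≤ Real.sqrt ‖z‖ := Real.le_sqrt_of_sq_le (by nlinarith)
      nlinarith [Real.mul_self_sqrt hz0.le, Real.sqrt_nonneg ‖z‖]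
    have h4 : 0 ≤ Real.log ‖z‖ := Real.log_nonneg (by linarith)
    calc c / 4 * ‖z‖ * Real.log ‖z‖ = c * (‖z‖ / 2) * (Real.log ‖z‖ / 2) := by ring
      _ ≤ _ := by
        apply mul_le_mul _ h2 (by positivity) (mul_nonneg hc.le (by linarith))
        gcongr
  · intro t ht
    exact ((hy1 _ (hpi t ht)).comp_of_eq t (dp t) rfl).congr_deriv (mul_comm _ _)
  · intro t ht
    exact ((hy2 _ (hpi t ht)).comp_of_eq t (dp t) rfl).congr_deriv (mul_comm _ _)
  · intro t ht
    refine (((hz1 _ (hpi t ht)).comp_of_eq t (dp t) rfl).const_mul e).congr_deriv (by ring)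
  · intro t ht
    refine (((hz2 _ (hpi t ht)).comp_of_eq t (dp t) rfl).const_mul e).congr_deriv (by ring)
  · intro t ht
    have ht' : 0 < t := by linarith
    have hs : 0 < t + b := by linarith
    have h1 := hQ (p t) (by rw [hpn t ht]; linarith) (hpi t ht)
    rw [hpn t ht] at h1
    have e1 : - e ^ 2 * (Q (p t) / 2) = ((-(A / (2 * (t + b) ^ 2)) : ℝ) : ℂ) - e ^ 2 * ((Q (p t) - A / (p t) ^ 2) / 2) := by
      have : ((t:ℂ) + b) ≠ 0 := by exact_mod_cast hs.ne'
      simp only [hp]; push_cast; field_simp; ring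
    rw [e1, sub_re, ofReal_re]
    have h2 := (abs_le.1 (Complex.abs_re_le_norm (e ^ 2 * ((Q (p t) - A / (p t) ^ 2) / 2)))).2
    rw [norm_mul, norm_pow, hen, one_pow, one_mul, norm_div, RCLike.norm_ofNat] at h2
    have h3 : C / (t + b) ^ 3 ≤ b / (t + b) ^ 3 := by gcongr; exact le_abs_self C
    have h4 : A / (2 * (t + b) ^ 2) ≤ (1 / 2) / (2 * (t + b) ^ 2) := by gcongr
    have h5 : (1 / 2) / (2 * (t + b) ^ 2) + b / (t + b) ^ 3 / 2 ≤ 1 / (4 * t ^ 2) := by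
      rw [show b / (t + b) ^ 3 / 2 = b / ((t + b) ^ 3 * 2) from div_div _ _ _, div_add_div _ _ (by positivity) (by positivity), div_le_div_iff₀ (by positivity) (by positivity)]
      have e5 : 1 * (2 * (t + b) ^ 2 * ((t + b) ^ 3 * 2)) - (1 / 2 * ((t + b) ^ 3 * 2) + 2 * (t + b) ^ 2 * b) * (4 * t ^ 2)
        = 4 * (t + b) ^ 2 * (3 * b ^ 2 * t + b ^ 3) := by ring
      have : 0 ≤ 4 * (t + b) ^ 2 * (3 * b ^ 2 * t + b ^ 3) := by positivity
      linarith
    linarith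
  · intro t ht
    have : y1 (p t) * (e * z2 (p t)) - y2 (p t) * (e * z1 (p t)) = e := by
      linear_combination e * hW _ (hpi t ht)
    simp only [this, normSq_eq_norm_sq, hen]; norm_num
  all_goals
    obtain ⟨g1, g2, g3, g4⟩ := hB (p t0) (hpn t0 le_rfl) (hpi t0 le_rfl)
    have := le_abs_self B
    try simp only [norm_mul, hen, one_mul]
    linarith

theorem int_radial {f : ℝ → ℝ} {S : Set ℝ} (hS : MeasurableSet S)
    (h : IntegrableOn (fun r => r * f r) (S ∩ Ioi 0)) :
    IntegrableOn (fun z : ℂ => f ‖z‖) {z : ℂ | ‖z‖ ∈ S} := by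
  have hm : MeasurableSet {z : ℂ | ‖z‖ ∈ S} := hS.preimage measurable_norm
  rw [← integrable_indicator_iff hm]
  have e : ({z : ℂ | ‖z‖ ∈ S}.indicator fun z : ℂ => f ‖z‖) = fun z : ℂ => (S.indicator f) ‖z‖ := by
    funext z; simp [indicator]
  rw [e, integrable_fun_norm_addHaar volume (f := S.indicator f)]
  simp only [Complex.finrank_real_complex, smul_eq_mul]
  have h := (integrable_indicator_iff (hS.inter measurableSet_Ioi)).2 h
  rw [inter_comm, ← indicator_indicator, integrable_indicator_iff measurableSet_Ioi] at h
  refine h.congr_fun (fun r _ => ?_) measurableSet_Ioi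
  by_cases hr : r ∈ S <;> simp [hr]

theorem deriv_aux {x : ℝ} (hx : 0 < x) (hl : Real.log x ≠ 0) :
    HasDerivAt (fun r => -(Real.log r)⁻¹) (x * (x ^ 2 * Real.log x ^ 2)⁻¹) x := by
  refine ((Real.hasDerivAt_log hx.ne').inv hl).neg.congr_deriv ?_
  field_simp

theorem int_inf {R : ℝ} (hR : 1 < R) :
    IntegrableOn (fun z : ℂ => (‖z‖ ^ 2 * Real.log ‖z‖ ^ 2)⁻¹) {z : ℂ | R ≤ ‖z‖} := by
  refine int_radial (f := fun r => (r ^ 2 * Real.log r ^ 2)⁻¹) (S := Ici R) measurableSet_Ici ?_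
  refine IntegrableOn.mono_set ?_ inter_subset_left
  rw [integrableOn_Ici_iff_integrableOn_Ioi]
  refine integrableOn_Ioi_deriv_of_nonneg' (g := fun r => -(Real.log r)⁻¹) (l := -0) ?_ ?_ ?_
  · intro x hx
    have hx1 : 1 < x := lt_of_lt_of_le hR hx
    exact deriv_aux (by linarith) (Real.log_pos hx1).ne'
  · intro x hx
    have : 0 < x := by have := mem_Ioi.1 hx; linarith
    positivity
  · exact (Real.tendsto_log_atTop.inv_tendsto_atTop).neg

theorem int_zero {R : ℝ} (hR : 1 < R) :
    IntegrableOn (fun z : ℂ => (‖z‖ ^ 2 * Real.log ‖z‖ ^ 2)⁻¹) {z : ℂ | ‖z‖ ≤ R⁻¹} := by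
  refine int_radial (f := fun r => (r ^ 2 * Real.log r ^ 2)⁻¹) (S := Iic R⁻¹) measurableSet_Iic ?_
  rw [inter_comm, Ioi_inter_Iic]
  have hR1 : R⁻¹ < 1 := inv_lt_one_of_one_lt₀ hR
  refine intervalIntegral.integrableOn_deriv_of_nonneg (g := fun r => -(Real.log r)⁻¹) ?_ ?_ ?_
  · intro x hx
    rcases hx.1.eq_or_lt with h | h
    · subst h
      rw [ContinuousWithinAt]
      simp only [Real.log_zero, inv_zero]
      refine Tendsto.neg ?_
      have h1 : Tendsto (fun r => (Real.log r)⁻¹) (nhdsWithin 0 {0}ᶜ) (nhds 0) :=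
        Real.tendsto_log_nhdsNE_zero.inv_tendsto_atBot
      have h2 : Tendsto (fun r => (Real.log r)⁻¹) (nhds 0) (nhds 0) := by
        refine Tendsto.mono_left (tendsto_sup.2 ⟨h1, ?_⟩) (nhdsNE_sup_pure (0:ℝ)).ge
        rw [tendsto_pure_left]
        intro s hs
        simpa using mem_of_mem_nhds hs
      exact h2.mono_left nhdsWithin_le_nhds
    · exact (deriv_aux h (Real.log_neg h (by linarith [hx.2])).ne).continuousAt.continuousWithinAt
  · intro x hx
    exact deriv_aux hx.1 (Real.log_neg hx.1 (by linarith [hx.2])).ne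
  · intro x hx
    have := hx.1
    positivity

theorem local_growth {y1 y2 z1 z2 Q : ℂ → ℂ}
    (hy1 : ∀ z : ℂ, 0 < z.im → HasDerivAt y1 (z1 z) z)
    (hy2 : ∀ z : ℂ, 0 < z.im → HasDerivAt y2 (z2 z) z)
    (hz1 : ∀ z : ℂ, 0 < z.im → HasDerivAt z1 (-(Q z / 2) * y1 z) z)
    (hz2 : ∀ z : ℂ, 0 < z.im → HasDerivAt z2 (-(Q z / 2) * y2 z) z)
    (hW : ∀ z : ℂ, 0 < z.im → y1 z * z2 z - y2 z * z1 z = 1)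
    (q A C δ : ℝ) (hδ : 0 < δ) (hA : A ≤ 1 / 2)
    (hQ : ∀ z : ℂ, ‖z - q‖ ≤ δ → 0 < z.im → ‖Q z - A / (z - q) ^ 2‖ ≤ C / ‖z - q‖)
    (hbd : ∀ r, 0 < r → r ≤ δ → ∃ B, ∀ z : ℂ, ‖z - q‖ = r → 0 < z.im →
      ‖y1 z‖ ≤ B ∧ ‖y2 z‖ ≤ B ∧ ‖z1 z‖ ≤ B ∧ ‖z2 z‖ ≤ B) :
    ∃ R > 1, ∃ c > 0, ∀ z : ℂ, ‖z - q‖ ≤ R⁻¹ → 0 < z.im →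
      c * ‖z - q‖ * |Real.log ‖z - q‖| ≤ normSq (y1 z) + normSq (y2 z) := by
  have hmap : ∀ ζ : ℂ, 0 < ζ.im → 0 < ((q:ℂ) - ζ⁻¹).im := by
    intro ζ h
    have : 0 < normSq ζ := normSq_pos.2 (fun h0 => by rw [h0] at h; simp at h)
    simp only [sub_im, ofReal_im, inv_im]
    rw [neg_div, zero_sub, neg_neg]
    positivity
  have hne : ∀ ζ : ℂ, 0 < ζ.im → ζ ≠ 0 := fun ζ h h0 => by rw [h0] at h; simp at h
  have hφ : ∀ ζ : ℂ, 0 < ζ.im → HasDerivAt (fun ζ : ℂ => (q:ℂ) - ζ⁻¹) ((ζ ^ 2)⁻¹) ζ := fun ζ h =>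
    ((hasDerivAt_inv (hne ζ h)).const_sub _).congr_deriv (by simp)
  have dY : ∀ y z1 : ℂ → ℂ, (∀ z : ℂ, 0 < z.im → HasDerivAt y (z1 z) z) → ∀ ζ : ℂ, 0 < ζ.im →
      HasDerivAt (fun ζ => ζ * y (q - ζ⁻¹)) (y (q - ζ⁻¹) + ζ⁻¹ * z1 (q - ζ⁻¹)) ζ := by
    intro y z1 hy ζ h
    have h1 := (hy _ (hmap ζ h)).comp ζ (hφ ζ h)
    refine ((hasDerivAt_id ζ).mul h1).congr_deriv ?_
    have := hne ζ h
    simp only [Function.comp, id]; field_simp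
  have dZ : ∀ y z1 : ℂ → ℂ, (∀ z : ℂ, 0 < z.im → HasDerivAt y (z1 z) z) →
      (∀ z : ℂ, 0 < z.im → HasDerivAt z1 (-(Q z / 2) * y z) z) → ∀ ζ : ℂ, 0 < ζ.im →
      HasDerivAt (fun ζ => y (q - ζ⁻¹) + ζ⁻¹ * z1 (q - ζ⁻¹))
        (-((Q (q - ζ⁻¹) / ζ ^ 4) / 2) * (ζ * y (q - ζ⁻¹))) ζ := by
    intro y z1 hy hz ζ h
    have h1 := (hy _ (hmap ζ h)).comp ζ (hφ ζ h)
    have h2 := (hz _ (hmap ζ h)).comp ζ (hφ ζ h)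
    refine (h1.add ((hasDerivAt_inv (hne ζ h)).mul h2)).congr_deriv ?_
    have := hne ζ h
    simp only [Function.comp]; field_simp; ring
  have HH := half_plane_growth (Q := fun ζ => Q (q - ζ⁻¹) / ζ ^ 4)
    (dY y1 z1 hy1) (dY y2 z2 hy2) (dZ y1 z1 hy1 hz1) (dZ y2 z2 hy2 hz2) ?_ A C δ⁻¹ (by positivity) hA ?_ ?_
  · obtain ⟨R, hR, c, hc, H⟩ := HH
    refine ⟨R, hR, c, hc, fun z hz hzi => ?_⟩
    set ζ : ℂ := (q - z)⁻¹ with hζ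
    have hqz : (q:ℂ) - z ≠ 0 := fun h => by
      have := congrArg Complex.im h
      simp at this; linarith
    have hzq : (z - q : ℂ) ≠ 0 := fun h => hqz (by linear_combination -h)
    have hzp : 0 < ‖z - q‖ := norm_pos_iff.2 hzq
    have e1 : (q:ℂ) - ζ⁻¹ = z := by rw [hζ, inv_inv]; ring
    have hn : ‖ζ‖ = ‖z - q‖⁻¹ := by rw [hζ, norm_inv, norm_sub_rev]
    have hζi : 0 < ζ.im := by
      rw [hζ, inv_im]
      have : 0 < normSq (q - z) := normSq_pos.2 hqz
      have h2 : -((q:ℂ) - z).im = z.im := by simp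
      rw [h2]; positivity
    have key := H ζ (by rw [hn]; exact (le_inv_comm₀ (by linarith) hzp).2 hz) hζi
    simp only [e1, normSq_mul] at key
    rw [normSq_eq_norm_sq ζ, hn, Real.log_inv] at key
    have hlog : Real.log ‖z - q‖ < 0 := Real.log_neg hzp (lt_of_le_of_lt hz (inv_lt_one_of_one_lt₀ hR))
    rw [abs_of_neg hlog]
    have h3 : ‖z - q‖ ^ 2 * (c * ‖z - q‖⁻¹ * -Real.log ‖z - q‖) ≤
      ‖z - q‖ ^ 2 * (‖z - q‖⁻¹ ^ 2 * normSq (y1 z) + ‖z - q‖⁻¹ ^ 2 * normSq (y2 z)) := by gcongr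
    have e3 : ‖z - q‖ ^ 2 * (c * ‖z - q‖⁻¹ * -Real.log ‖z - q‖) = c * ‖z - q‖ * -Real.log ‖z - q‖ := by
      field_simp
    have e4 : ‖z - q‖ ^ 2 * (‖z - q‖⁻¹ ^ 2 * normSq (y1 z) + ‖z - q‖⁻¹ ^ 2 * normSq (y2 z)) =
      normSq (y1 z) + normSq (y2 z) := by field_simp
    rw [e3, e4] at h3
    exact h3
  · intro ζ h
    have h1 := hW _ (hmap ζ h)
    have := hne ζ h
    rw [← h1]; field_simp; ring
  · intro ζ h hi
    have h0 := hne ζ hi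
    have hn : ‖(q:ℂ) - ζ⁻¹ - q‖ = ‖ζ‖⁻¹ := by rw [sub_sub_cancel_left, norm_neg, norm_inv]
    have h1 := hQ (q - ζ⁻¹) (by rw [hn]; exact inv_le_of_inv_le₀ hδ h) (hmap ζ hi)
    rw [hn] at h1
    have e1 : Q (q - ζ⁻¹) / ζ ^ 4 - A / ζ ^ 2 = (Q (q - ζ⁻¹) - A / ((q:ℂ) - ζ⁻¹ - q) ^ 2) / ζ ^ 4 := by
      rw [sub_sub_cancel_left]; field_simp
    have hp : 0 < ‖ζ‖ := norm_pos_iff.2 h0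
    simp only [e1, norm_div, norm_pow]
    rw [div_le_iff₀ (by positivity)]
    refine h1.trans (le_of_eq ?_)
    field_simp
  · intro r hr
    have hr0 : 0 < r := lt_of_lt_of_le (by positivity) hr
    obtain ⟨B, hB⟩ := hbd r⁻¹ (by positivity) (inv_le_of_inv_le₀ hδ hr)
    refine ⟨max (r * B) (B + r⁻¹ * B), fun ζ h hi => ?_⟩
    obtain ⟨b1, b2, b3, b4⟩ := hB (q - ζ⁻¹) (by rw [sub_sub_cancel_left, norm_neg, norm_inv, h]) (hmap ζ hi)
    refine ⟨le_max_of_le_left ?_, le_max_of_le_left ?_, le_max_of_le_right ?_, le_max_of_le_right ?_⟩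
    · rw [norm_mul, h]; gcongr
    · rw [norm_mul, h]; gcongr
    · refine (norm_add_le _ _).trans ?_
      rw [norm_mul, norm_inv, h]; gcongr
    · refine (norm_add_le _ _).trans ?_
      rw [norm_mul, norm_inv, h]; gcongr

/-- M = |y₁|² + |y₂|² -/
noncomputable def Mf (y1 y2 : ℂ → ℂ) (z : ℂ) : ℝ := normSq (y1 z) + normSq (y2 z)

/-- M_z -/
noncomputable def Gf (y1 y2 z1 z2 : ℂ → ℂ) (z : ℂ) : ℂ :=
  z1 z * (starRingEnd ℂ) (y1 z) + z2 z * (starRingEnd ℂ) (y2 z)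

/-- the solution v -/
noncomputable def vf (y1 y2 : ℂ → ℂ) (z : ℂ) : ℝ := 2 * Real.log (2 / Mf y1 y2 z)

/-- v_z -/
noncomputable def Vf (y1 y2 z1 z2 : ℂ → ℂ) (z : ℂ) : ℂ := -2 * Gf y1 y2 z1 z2 z / Mf y1 y2 z

/-- real-linear map h ↦ a h + c conj h -/
noncomputable def linab (a c : ℂ) : ℂ →L[ℝ] ℂ :=
  a • (1 : ℂ →L[ℝ] ℂ) + c • (Complex.conjCLE : ℂ →L[ℝ] ℂ)

theorem linab_apply (a c h : ℂ) : linab a c h = a * h + c * (starRingEnd ℂ) h := by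
  simp [linab]

/-- real-linear map h ↦ 2 Re (a h) -/
noncomputable def linre (a : ℂ) : ℂ →L[ℝ] ℝ := (2:ℝ) • (Complex.reCLM.comp (a • (1 : ℂ →L[ℝ] ℂ)))

theorem linre_apply (a h : ℂ) : linre a h = 2 * (a * h).re := by
  simp [linre]

theorem hasFDerivAt_cplx {y : ℂ → ℂ} {d z : ℂ} (h : HasDerivAt y d z) :
    HasFDerivAt y (d • (1 : ℂ →L[ℝ] ℂ)) z := h.complexToReal_fderiv

theorem hasFDerivAt_conj {y : ℂ → ℂ} {d z : ℂ} (h : HasDerivAt y d z) :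
    HasFDerivAt (fun w => (starRingEnd ℂ) (y w))
      ((Complex.conjCLE : ℂ →L[ℝ] ℂ).comp (d • (1 : ℂ →L[ℝ] ℂ))) z :=
  (Complex.conjCLE : ℂ →L[ℝ] ℂ).hasFDerivAt.comp z (hasFDerivAt_cplx h)

theorem Mf_fderiv {y1 y2 z1 z2 : ℂ → ℂ} {z : ℂ} (h1 : HasDerivAt y1 (z1 z) z)
    (h2 : HasDerivAt y2 (z2 z) z) :
    HasFDerivAt (Mf y1 y2) (linre (Gf y1 y2 z1 z2 z)) z := by
  have r1 := Complex.reCLM.hasFDerivAt.comp z (hasFDerivAt_cplx h1)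
  have i1 := Complex.imCLM.hasFDerivAt.comp z (hasFDerivAt_cplx h1)
  have r2 := Complex.reCLM.hasFDerivAt.comp z (hasFDerivAt_cplx h2)
  have i2 := Complex.imCLM.hasFDerivAt.comp z (hasFDerivAt_cplx h2)
  have := ((r1.mul r1).add (i1.mul i1)).add ((r2.mul r2).add (i2.mul i2))
  refine HasFDerivAt.congr_fderiv this ?_
  refine ContinuousLinearMap.ext fun h => ?_
  simp [linre_apply, Gf]
  ring

theorem Gf_fderiv {y1 y2 z1 z2 k : ℂ → ℂ} {z : ℂ} (h1 : HasDerivAt y1 (z1 z) z)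
    (h2 : HasDerivAt y2 (z2 z) z) (h3 : HasDerivAt z1 (k z * y1 z) z)
    (h4 : HasDerivAt z2 (k z * y2 z) z) :
    HasFDerivAt (Gf y1 y2 z1 z2) (linab (k z * Mf y1 y2 z) (Mf z1 z2 z : ℝ)) z := by
  have := ((hasFDerivAt_cplx h3).mul (hasFDerivAt_conj h1)).add
    ((hasFDerivAt_cplx h4).mul (hasFDerivAt_conj h2))
  refine HasFDerivAt.congr_fderiv this ?_
  refine ContinuousLinearMap.ext fun h => ?_
  rw [linab_apply, Mf, Mf]
  simp
  simp only [← mul_conj]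
  ring

theorem Vf_fderiv {y1 y2 z1 z2 k : ℂ → ℂ} {z : ℂ} (h1 : HasDerivAt y1 (z1 z) z)
    (h2 : HasDerivAt y2 (z2 z) z) (h3 : HasDerivAt z1 (k z * y1 z) z)
    (h4 : HasDerivAt z2 (k z * y2 z) z) (hM : 0 < Mf y1 y2 z) :
    HasFDerivAt (Vf y1 y2 z1 z2) (linab
      (-2 * k z + 2 * (Gf y1 y2 z1 z2 z) ^ 2 / (Mf y1 y2 z : ℂ) ^ 2)
      (-2 * (Mf z1 z2 z : ℝ) / (Mf y1 y2 z : ℂ) + 2 * normSq (Gf y1 y2 z1 z2 z) / (Mf y1 y2 z : ℂ) ^ 2)) z := by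
  have hG := Gf_fderiv h1 h2 h3 h4
  have hMd := Mf_fderiv h1 h2
  have hMi : HasFDerivAt (fun w => (Mf y1 y2 w)⁻¹) (-(Mf y1 y2 z ^ 2)⁻¹ • linre (Gf y1 y2 z1 z2 z)) z :=
    (hasDerivAt_inv hM.ne').comp_hasFDerivAt z hMd
  have hMc := Complex.ofRealCLM.hasFDerivAt.comp z hMi
  have := (hG.const_mul (-2)).mul hMc
  have hMne : (Mf y1 y2 z : ℂ) ≠ 0 := by exact_mod_cast hM.ne'
  have e : Vf y1 y2 z1 z2 = (fun w => (-2 * Gf y1 y2 z1 z2 w)) * (Complex.ofRealCLM ∘ fun w => (Mf y1 y2 w)⁻¹) := by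
    funext w; simp [Vf, div_eq_mul_inv]
  rw [e]
  refine HasFDerivAt.congr_fderiv this ?_
  refine ContinuousLinearMap.ext fun h => ?_
  have e2 : ∀ a : ℂ, ((2 * a.re : ℝ) : ℂ) = a + (starRingEnd ℂ) a := fun a => by
    rw [add_conj]
  simp only [add_apply, smul_apply, ContinuousLinearMap.comp_apply, Function.comp,
    linab_apply,
    Complex.ofRealCLM_apply, smul_eq_mul, linre_apply]
  push_cast
  have e3 := e2 (Gf y1 y2 z1 z2 z * h)
  push_cast at e3
  rw [e3, map_mul, ← mul_conj]
  field_simp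
  ring

theorem vf_fderiv {y1 y2 z1 z2 : ℂ → ℂ} {z : ℂ} (h1 : HasDerivAt y1 (z1 z) z)
    (h2 : HasDerivAt y2 (z2 z) z) (hM : 0 < Mf y1 y2 z) :
    HasFDerivAt (vf y1 y2) (linre (Vf y1 y2 z1 z2 z)) z := by
  have hMd := Mf_fderiv h1 h2
  have hd : HasDerivAt (fun m : ℝ => 2 * Real.log (2 / m)) (-2 / Mf y1 y2 z) (Mf y1 y2 z) := by
    have a1 : HasDerivAt (fun m : ℝ => 2 / m) (2 * -(Mf y1 y2 z ^ 2)⁻¹) (Mf y1 y2 z) := by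
      simpa [div_eq_mul_inv] using (hasDerivAt_inv hM.ne').const_mul (2:ℝ)
    refine ((a1.log (by positivity)).const_mul 2).congr_deriv ?_
    field_simp
  refine HasFDerivAt.congr_fderiv (hd.comp_hasFDerivAt z hMd) ?_
  refine ContinuousLinearMap.ext fun h => ?_
  have e : Vf y1 y2 z1 z2 z * h = ((-2 / Mf y1 y2 z : ℝ) : ℂ) * (Gf y1 y2 z1 z2 z * h) := by
    simp only [Vf]; push_cast; ring
  rw [linre_apply, e, re_ofReal_mul]
  simp [linre_apply]; ring

theorem vf_exp_half {y1 y2 : ℂ → ℂ} {z : ℂ} (hM : 0 < Mf y1 y2 z) :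
    Real.exp (vf y1 y2 z / 2) = 2 / Mf y1 y2 z := by
  rw [vf, mul_div_cancel_left₀ _ two_ne_zero, Real.exp_log (by positivity)]

theorem vf_exp {y1 y2 : ℂ → ℂ} {z : ℂ} (hM : 0 < Mf y1 y2 z) :
    Real.exp (vf y1 y2 z) = 4 / Mf y1 y2 z ^ 2 := by
  have : vf y1 y2 z = vf y1 y2 z / 2 + vf y1 y2 z / 2 := by ring
  rw [this, Real.exp_add, vf_exp_half hM]; field_simp; norm_num

theorem Mf_pos {y1 y2 z1 z2 : ℂ → ℂ} {z : ℂ} (hW : y1 z * z2 z - y2 z * z1 z = 1) : 0 < Mf y1 y2 z := by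
  have h1 := lagrange_aux (y1 z) (y2 z) (z1 z) (z2 z)
  rw [hW, normSq_one] at h1
  have h3 : 0 ≤ Mf y1 y2 z := add_nonneg (normSq_nonneg _) (normSq_nonneg _)
  rcases h3.lt_or_eq with h | h
  · exact h
  · simp only [Mf] at h; rw [← h] at h1; linarith

theorem wronsk_aux {y1 y2 z1 z2 : ℂ → ℂ} {z : ℂ} (hW : y1 z * z2 z - y2 z * z1 z = 1) :
    Mf z1 z2 z * Mf y1 y2 z - normSq (Gf y1 y2 z1 z2 z) = 1 := by
  have h1 : normSq (y1 z * z2 z - y2 z * z1 z) = 1 := by rw [hW, normSq_one]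
  rw [← h1]
  simp only [Mf, Gf, normSq_apply, mul_re, mul_im, sub_re, sub_im, add_re, add_im, conj_re, conj_im]
  ring

theorem vf_lap {y1 y2 z1 z2 k : ℂ → ℂ} {D : Set ℂ} (hD : IsOpen D)
    (h1 : ∀ z ∈ D, HasDerivAt y1 (z1 z) z) (h2 : ∀ z ∈ D, HasDerivAt y2 (z2 z) z)
    (h3 : ∀ z ∈ D, HasDerivAt z1 (k z * y1 z) z) (h4 : ∀ z ∈ D, HasDerivAt z2 (k z * y2 z) z)
    (hW : ∀ z ∈ D, y1 z * z2 z - y2 z * z1 z = 1) {z : ℂ} (hz : z ∈ D) :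
    lap (vf y1 y2) z + 2 * 1 * Real.exp (vf y1 y2 z) = 0 := by
  have hM := Mf_pos (hW z hz)
  have hV := Vf_fderiv (h1 z hz) (h2 z hz) (h3 z hz) (h4 z hz) hM
  have ev : ∀ h : ℂ, (fun w => fderiv ℝ (vf y1 y2) w h) =ᶠ[nhds z] fun w => 2 * (Vf y1 y2 z1 z2 w * h).re := by
    intro h
    filter_upwards [hD.mem_nhds hz] with w hw
    rw [(vf_fderiv (h1 w hw) (h2 w hw) (Mf_pos (hW w hw))).fderiv, linre_apply]
  have hd : ∀ h : ℂ, fderiv ℝ (fun w => fderiv ℝ (vf y1 y2) w h) z h =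
      2 * ((linab (-2 * k z + 2 * (Gf y1 y2 z1 z2 z) ^ 2 / (Mf y1 y2 z : ℂ) ^ 2)
      (-2 * (Mf z1 z2 z : ℝ) / (Mf y1 y2 z : ℂ) + 2 * normSq (Gf y1 y2 z1 z2 z) / (Mf y1 y2 z : ℂ) ^ 2)) h * h).re := by
    intro h
    rw [(ev h).fderiv_eq]
    have a1 := Complex.reCLM.hasFDerivAt.comp z (hV.mul_const h)
    have a2 : HasFDerivAt (fun w => 2 * (Vf y1 y2 z1 z2 w * h).re) _ z := a1.const_mul 2
    rw [a2.fderiv]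
    simp [mul_comm]
  rw [lap, hd, hd, vf_exp hM, linab_apply, linab_apply]
  have hw := wronsk_aux (hW z hz)
  have e : (-2 * (Mf z1 z2 z : ℝ) / (Mf y1 y2 z : ℂ) + 2 * normSq (Gf y1 y2 z1 z2 z) / (Mf y1 y2 z : ℂ) ^ 2)
      = ((-2 / Mf y1 y2 z ^ 2 : ℝ) : ℂ) := by
    have hMne : (Mf y1 y2 z : ℂ) ≠ 0 := by exact_mod_cast hM.ne'
    have hw' : (Mf z1 z2 z : ℂ) * Mf y1 y2 z - normSq (Gf y1 y2 z1 z2 z) = 1 := by exact_mod_cast hw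
    push_cast
    field_simp
    linear_combination (-1 : ℂ) * hw'
  rw [e]
  generalize (-2 * k z + 2 * (Gf y1 y2 z1 z2 z) ^ 2 / (Mf y1 y2 z : ℂ) ^ 2) = a
  generalize hr : (-2 / Mf y1 y2 z ^ 2 : ℝ) = r
  have : 4 / Mf y1 y2 z ^ 2 = -2 * r := by rw [← hr]; ring
  rw [this]
  simp
  ring

theorem vf_schwarz {y1 y2 z1 z2 k : ℂ → ℂ} {D : Set ℂ} (hD : IsOpen D)
    (h1 : ∀ z ∈ D, HasDerivAt y1 (z1 z) z) (h2 : ∀ z ∈ D, HasDerivAt y2 (z2 z) z)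
    (h3 : ∀ z ∈ D, HasDerivAt z1 (k z * y1 z) z) (h4 : ∀ z ∈ D, HasDerivAt z2 (k z * y2 z) z)
    (hW : ∀ z ∈ D, y1 z * z2 z - y2 z * z1 z = 1) {z : ℂ} (hz : z ∈ D) (hzi : 0 < z.im) :
    schwarzianMap (vf y1 y2) z = -2 * k z := by
  have hM := Mf_pos (hW z hz)
  have hV := Vf_fderiv (h1 z hz) (h2 z hz) (h3 z hz) (h4 z hz) hM
  have hU : ∀ w : ℂ, 0 < w.im → {w : ℂ | 0 ≤ w.im} ∈ nhds w := fun w hw =>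
    mem_of_superset ((isOpen_lt continuous_const Complex.continuous_im).mem_nhds hw) (fun u (hu : 0 < u.im) => show 0 ≤ u.im from hu.le)
  have ev : vzc (vf y1 y2) =ᶠ[nhds z] Vf y1 y2 z1 z2 := by
    filter_upwards [hD.mem_nhds hz, (isOpen_lt continuous_const Complex.continuous_im).mem_nhds hzi] with w hw hwi
    rw [vzc, fderivWithin_of_mem_nhds (hU w hwi),
      (vf_fderiv (h1 w hw) (h2 w hw) (Mf_pos (hW w hw))).fderiv, linre_apply, linre_apply]
    apply Complex.ext <;> simp
  rw [schwarzianMap, fderivWithin_of_mem_nhds (hU z hzi), ev.fderiv_eq, hV.fderiv, ev.eq_of_nhds,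
    linab_apply, linab_apply, Vf]
  simp only [map_one, conj_I]
  have hMne : (Mf y1 y2 z : ℂ) ≠ 0 := by exact_mod_cast hM.ne'
  field_simp
  ring_nf
  simp only [I_sq]
  ring

theorem vf_dnu {y1 y2 z1 z2 : ℂ → ℂ} {s : ℝ} (h1 : HasDerivAt y1 (z1 s) s)
    (h2 : HasDerivAt y2 (z2 s) s) (hW : y1 s * z2 s - y2 s * z1 s = 1) :
    dnu (vf y1 y2) s = 2 * (Gf y1 y2 z1 z2 s).im * Real.exp (vf y1 y2 s / 2) := by
  have hM := Mf_pos hW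
  have hconv : Convex ℝ {w : ℂ | 0 ≤ w.im} := convex_halfSpace_im_ge 0
  have hud : UniqueDiffWithinAt ℝ {w : ℂ | 0 ≤ w.im} (s:ℂ) := by
    refine uniqueDiffWithinAt_convex hconv ⟨I, ?_⟩ (subset_closure (by simp))
    exact mem_interior.2 ⟨{w : ℂ | 0 < w.im}, fun u (hu : 0 < u.im) => show 0 ≤ u.im from hu.le,
      isOpen_lt continuous_const Complex.continuous_im, by simp⟩
  rw [dnu, (vf_fderiv h1 h2 hM).hasFDerivWithinAt.fderivWithin hud, linre_apply, vf_exp_half hM, Vf]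
  have e : -2 * Gf y1 y2 z1 z2 s / (Mf y1 y2 s : ℂ) * I = ((-2 / Mf y1 y2 s : ℝ) : ℂ) * (Gf y1 y2 z1 z2 s * I) := by
    push_cast; ring
  rw [e, re_ofReal_mul]
  simp; ring

theorem Gf_im_deriv {y1 y2 z1 z2 k : ℂ → ℂ} {s : ℝ} (h1 : HasDerivAt y1 (z1 s) s)
    (h2 : HasDerivAt y2 (z2 s) s) (h3 : HasDerivAt z1 (k s * y1 s) s)
    (h4 : HasDerivAt z2 (k s * y2 s) s) (hk : (k s).im = 0) :
    HasDerivAt (fun s : ℝ => (Gf y1 y2 z1 z2 s).im) 0 s := by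
  have hG := Gf_fderiv h1 h2 h3 h4
  have hs : HasDerivAt (fun s : ℝ => (s:ℂ)) 1 s := Complex.ofRealCLM.hasDerivAt
  have := hasDerivAt_im' (hG.comp_hasDerivAt s hs)
  refine this.congr_deriv ?_
  rw [linab_apply]; simp [hk]

theorem vf_contDiff {y1 y2 z1 z2 : ℂ → ℂ} {D : Set ℂ} (hD : IsOpen D)
    (h1 : ∀ z ∈ D, HasDerivAt y1 (z1 z) z) (h2 : ∀ z ∈ D, HasDerivAt y2 (z2 z) z)
    (hW : ∀ z ∈ D, y1 z * z2 z - y2 z * z1 z = 1) : ContDiffOn ℝ 2 (vf y1 y2) D := by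
  have c1 : ContDiffOn ℝ 2 y1 D := (DifferentiableOn.contDiffOn (n := 2)
    (fun z hz => (h1 z hz).differentiableAt.differentiableWithinAt) hD).restrict_scalars ℝ
  have c2 : ContDiffOn ℝ 2 y2 D := (DifferentiableOn.contDiffOn (n := 2)
    (fun z hz => (h2 z hz).differentiableAt.differentiableWithinAt) hD).restrict_scalars ℝ
  have hM : ContDiffOn ℝ 2 (Mf y1 y2) D := by
    have r1 := Complex.reCLM.contDiff.comp_contDiffOn c1
    have i1 := Complex.imCLM.contDiff.comp_contDiffOn c1
    have r2 := Complex.reCLM.contDiff.comp_contDiffOn c2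
    have i2 := Complex.imCLM.contDiff.comp_contDiffOn c2
    exact ((r1.mul r1).add (i1.mul i1)).add ((r2.mul r2).add (i2.mul i2))
  have hp : ∀ z ∈ D, Mf y1 y2 z ≠ 0 := fun z hz => (Mf_pos (hW z hz)).ne'
  exact contDiffOn_const.mul ((contDiffOn_const.div hM hp).log
    (fun z hz => div_ne_zero two_ne_zero (hp z hz)))


/-- the domain: the plane with downward slits at the points q i removed -/
def slitD (m : ℕ) (q : Fin m → ℝ) : Set ℂ :=
  {z | ∀ i, ¬ (z.im ≤ 0 ∧ z.re = (1 - z.im) * q i)}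

theorem slitD_open (m : ℕ) (q : Fin m → ℝ) : IsOpen (slitD m q) := by
  have : slitD m q = ⋂ i, {z : ℂ | z.im ≤ 0 ∧ z.re = (1 - z.im) * q i}ᶜ := by
    ext z; simp [slitD]
  rw [this]
  refine isOpen_iInter_of_finite fun i => ?_
  rw [isOpen_compl_iff]
  exact (isClosed_le Complex.continuous_im continuous_const).inter
    (isClosed_eq Complex.continuous_re ((continuous_const.sub Complex.continuous_im).mul continuous_const))

theorem slitD_upper {m : ℕ} {q : Fin m → ℝ} {z : ℂ} (hz : 0 ≤ z.im) (h : ∀ i, z ≠ q i) :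
    z ∈ slitD m q := by
  rintro i ⟨h1, h2⟩
  have h3 : z.im = 0 := le_antisymm h1 hz
  apply h i
  apply Complex.ext <;> simp [h2, h3]

theorem slitD_H {m : ℕ} {q : Fin m → ℝ} {z : ℂ} (hz : 0 < z.im) : z ∈ slitD m q :=
  fun _ h => absurd h.1 (not_le.2 hz)

theorem slitD_ne {m : ℕ} {q : Fin m → ℝ} {z : ℂ} (hz : z ∈ slitD m q) (i : Fin m) : z - q i ≠ 0 := by
  intro h
  have : z = q i := sub_eq_zero.1 h
  apply hz i
  simp [this]

theorem slitD_star (m : ℕ) (q : Fin m → ℝ) : RadStar I (slitD m q) := by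
  rintro z hz s ⟨hs0, hs1⟩ i ⟨h1, h2⟩
  simp at h1 h2
  rcases hs0.lt_or_eq with h | h
  · have e : z.re = (1 - z.im) * q i := by
      apply mul_left_cancel₀ h.ne'
      rw [h2]; ring
    have hp : 0 < z.im := by
      by_contra hc
      exact hz i ⟨not_lt.1 hc, e⟩
    nlinarith [mul_pos h hp]
  · rw [← h] at h1; simp at h1; linarith

theorem slitD_preconn (m : ℕ) (q : Fin m → ℝ) : IsPreconnected (slitD m q) := by
  have h : StarConvex ℝ I (slitD m q) := by
    intro z hz a b ha hb hab
    have := slitD_star m q z hz b ⟨hb, by linarith⟩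
    convert this using 1
    have : (a:ℂ) = 1 - b := by rw [← ofReal_one, ← hab]; push_cast; ring
    simp [this]; ring
  exact (h.isPathConnected (slitD_H (by simp))).isConnected.isPreconnected

/-- the Schwarzian -/
noncomputable def Qf (m : ℕ) (q α β : Fin m → ℝ) (z : ℂ) : ℂ :=
  ∑ i, (((α i : ℝ) : ℂ) / (z - (q i : ℂ)) ^ 2 + ((β i : ℝ) : ℂ) / (z - (q i : ℂ)))

theorem Qf_diff (m : ℕ) (q α β : Fin m → ℝ) : DifferentiableOn ℂ (Qf m q α β) (slitD m q) := by
  intro z hz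
  apply DifferentiableAt.differentiableWithinAt
  unfold Qf
  apply DifferentiableAt.fun_sum
  intro i _
  have := slitD_ne hz i
  fun_prop (disch := simp [this])

theorem Qf_real (m : ℕ) (q α β : Fin m → ℝ) (s : ℝ) : (Qf m q α β s).im = 0 := by
  have : Qf m q α β s = ((∑ i, (α i / (s - q i) ^ 2 + β i / (s - q i)) : ℝ) : ℂ) := by
    simp [Qf]
  rw [this, ofReal_im]

theorem inf_term (a b q : ℝ) (z : ℂ) (hz : 2 * |q| + 1 ≤ ‖z‖) :
    ‖(a / (z - q) ^ 2 + b / (z - q) - b / z - ((a + q * b : ℝ) : ℂ) / z ^ 2 : ℂ)‖ ≤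
      (4 * |a| * (2 * |q| + q ^ 2) + 2 * |b| * q ^ 2) / ‖z‖ ^ 3 := by
  have hq0 := abs_nonneg q
  have hz1 : 1 ≤ ‖z‖ := by linarith
  have hzp : 0 < ‖z‖ := by linarith
  have hd : ‖z‖ / 2 ≤ ‖z - q‖ := by
    have := norm_sub_norm_le z (q:ℂ)
    rw [Complex.norm_real, Real.norm_eq_abs] at this
    linarith
  have hdp : 0 < ‖z - q‖ := by linarith
  have z0 : z ≠ 0 := norm_pos_iff.1 hzp
  have z1 : z - q ≠ 0 := norm_pos_iff.1 hdp
  have e : (a / (z - q) ^ 2 + b / (z - q) - b / z - ((a + q * b : ℝ) : ℂ) / z ^ 2 : ℂ) =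
      a * (2 * q * z - q ^ 2) / (z ^ 2 * (z - q) ^ 2) + b * q ^ 2 / (z ^ 2 * (z - q)) := by
    push_cast
    field_simp
    ring
  rw [e, add_div]
  refine (norm_add_le _ _).trans (add_le_add ?_ ?_)
  · have n1 : ‖(2 * q * z - q ^ 2 : ℂ)‖ ≤ (2 * |q| + q ^ 2) * ‖z‖ := by
      refine (norm_sub_le _ _).trans ?_
      simp only [norm_mul, norm_pow, Complex.norm_real, Real.norm_eq_abs, sq_abs, Complex.norm_ofNat]
      nlinarith [sq_nonneg q]
    have n2 : ‖z‖ ^ 2 / 4 ≤ ‖z - q‖ ^ 2 := by nlinarith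
    rw [norm_div, norm_mul, norm_mul, norm_pow, norm_pow, Complex.norm_real, Real.norm_eq_abs]
    calc |a| * ‖(2 * q * z - q ^ 2 : ℂ)‖ / (‖z‖ ^ 2 * ‖z - q‖ ^ 2)
        ≤ |a| * ((2 * |q| + q ^ 2) * ‖z‖) / (‖z‖ ^ 2 * (‖z‖ ^ 2 / 4)) := by gcongr
      _ = _ := by field_simp
  · rw [norm_div, norm_mul, norm_mul, norm_pow, norm_pow, Complex.norm_real, Complex.norm_real,
      Real.norm_eq_abs, Real.norm_eq_abs, sq_abs]
    calc |b| * q ^ 2 / (‖z‖ ^ 2 * ‖z - q‖)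
        ≤ |b| * q ^ 2 / (‖z‖ ^ 2 * (‖z‖ / 2)) := by gcongr
      _ = _ := by field_simp

theorem Qf_inf (m : ℕ) (q α β : Fin m → ℝ) (hβ : ∑ i, β i = 0) :
    ∃ C : ℝ, ∀ z : ℂ, 2 * ∑ i, |q i| + 1 ≤ ‖z‖ →
      ‖Qf m q α β z - ((∑ i, (α i + q i * β i) : ℝ) : ℂ) / z ^ 2‖ ≤ C / ‖z‖ ^ 3 := by
  refine ⟨∑ i, (4 * |α i| * (2 * |q i| + q i ^ 2) + 2 * |β i| * q i ^ 2), fun z hz => ?_⟩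
  have e : Qf m q α β z - ((∑ i, (α i + q i * β i) : ℝ) : ℂ) / z ^ 2 =
      ∑ i, ((α i) / (z - q i) ^ 2 + (β i) / (z - q i) - (β i) / z - ((α i + q i * β i : ℝ) : ℂ) / z ^ 2 : ℂ) := by
    have hb : ∑ i, ((β i : ℝ) : ℂ) / z = 0 := by
      rw [← Finset.sum_div, ← ofReal_sum, hβ]; simp
    rw [Finset.sum_sub_distrib, Finset.sum_sub_distrib, hb, ← Finset.sum_div, Qf, ofReal_sum, sub_zero]
  rw [e, Finset.sum_div]
  refine (norm_sum_le _ _).trans (Finset.sum_le_sum fun i _ => inf_term _ _ _ _ ?_)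
  have := Finset.single_le_sum (f := fun i => |q i|) (fun i _ => abs_nonneg _) (Finset.mem_univ i)
  linarith

theorem exists_sep (m : ℕ) (q : Fin m → ℝ) (hq : StrictMono q) (i : Fin m) :
    ∃ δ > 0, ∀ j, j ≠ i → 2 * δ ≤ |q j - q i| := by
  have h : ∀ᶠ δ in nhdsWithin (0:ℝ) (Ioi 0), ∀ j, j ≠ i → 2 * δ ≤ |q j - q i| := by
    rw [eventually_all]
    intro j
    by_cases hj : j = i
    · simp [hj]
    · have : 0 < |q j - q i| := abs_pos.2 (sub_ne_zero.2 (hq.injective.ne hj))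
      filter_upwards [Ioo_mem_nhdsGT (show (0:ℝ) < |q j - q i| / 2 by linarith)] with δ hδ _
      linarith [hδ.2]
  obtain ⟨δ, h1, h2⟩ := (h.and self_mem_nhdsWithin).exists
  exact ⟨δ, h2, h1⟩

theorem sep_norm {m : ℕ} {q : Fin m → ℝ} {i : Fin m} {δ : ℝ} (h : ∀ j, j ≠ i → 2 * δ ≤ |q j - q i|)
    {z : ℂ} (hz : ‖z - q i‖ ≤ δ) (j : Fin m) (hj : j ≠ i) : δ ≤ ‖z - q j‖ := by
  have h1 := h j hj
  have h2 : |q j - q i| ≤ ‖z - q i‖ + ‖z - q j‖ := by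
    rw [← Real.norm_eq_abs, ← Complex.norm_real]
    have : ((q j - q i : ℝ) : ℂ) = (z - q i) - (z - q j) := by push_cast; ring
    rw [this]; exact norm_sub_le _ _
  linarith

theorem Qf_loc (m : ℕ) (q α β : Fin m → ℝ) (i : Fin m) (δ : ℝ) (hδ : 0 < δ)
    (h : ∀ j, j ≠ i → 2 * δ ≤ |q j - q i|) :
    ∃ C : ℝ, ∀ z : ℂ, ‖z - q i‖ ≤ δ → 0 < z.im →
      ‖Qf m q α β z - ((α i : ℝ) : ℂ) / (z - q i) ^ 2‖ ≤ C / ‖z - q i‖ := by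
  set B := ∑ j ∈ Finset.univ.erase i, (|α j| / δ ^ 2 + |β j| / δ) with hB
  have hB0 : 0 ≤ B := Finset.sum_nonneg fun j _ => by positivity
  refine ⟨|β i| + B * δ, fun z hz hzi => ?_⟩
  have hp : 0 < ‖z - q i‖ := norm_pos_iff.2 (slitD_ne (slitD_H hzi) i)
  have e : Qf m q α β z - ((α i : ℝ) : ℂ) / (z - q i) ^ 2 = ((β i : ℝ) : ℂ) / (z - q i) +
      ∑ j ∈ Finset.univ.erase i, (((α j : ℝ) : ℂ) / (z - (q j : ℂ)) ^ 2 + ((β j : ℝ) : ℂ) / (z - (q j : ℂ))) := by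
    rw [Qf, ← Finset.add_sum_erase _ _ (Finset.mem_univ i)]; ring
  rw [e, add_div]
  refine (norm_add_le _ _).trans (add_le_add ?_ ?_)
  · rw [norm_div, Complex.norm_real, Real.norm_eq_abs]
  · have h1 : B ≤ B * δ / ‖z - q i‖ := by
      rw [le_div_iff₀ hp]; gcongr
    refine le_trans ?_ h1
    refine (norm_sum_le _ _).trans (Finset.sum_le_sum fun j hj => ?_)
    have hs := sep_norm h hz j (Finset.ne_of_mem_erase hj)
    refine (norm_add_le _ _).trans ?_
    rw [norm_div, norm_div, norm_pow, Complex.norm_real, Complex.norm_real, Real.norm_eq_abs, Real.norm_eq_abs]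
    gcongr

theorem bound4 {K D : Set ℂ} (hK : IsCompact K) (hKD : K ⊆ D) {f1 f2 f3 f4 : ℂ → ℂ}
    (h1 : ContinuousOn f1 D) (h2 : ContinuousOn f2 D) (h3 : ContinuousOn f3 D) (h4 : ContinuousOn f4 D) :
    ∃ B : ℝ, ∀ z ∈ K, ‖f1 z‖ ≤ B ∧ ‖f2 z‖ ≤ B ∧ ‖f3 z‖ ≤ B ∧ ‖f4 z‖ ≤ B := by
  obtain ⟨B1, hB1⟩ := hK.exists_bound_of_continuousOn (h1.mono hKD)
  obtain ⟨B2, hB2⟩ := hK.exists_bound_of_continuousOn (h2.mono hKD)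
  obtain ⟨B3, hB3⟩ := hK.exists_bound_of_continuousOn (h3.mono hKD)
  obtain ⟨B4, hB4⟩ := hK.exists_bound_of_continuousOn (h4.mono hKD)
  refine ⟨max (max B1 B2) (max B3 B4), fun z hz => ⟨?_, ?_, ?_, ?_⟩⟩
  · exact (hB1 z hz).trans (by simp)
  · exact (hB2 z hz).trans (by simp)
  · exact (hB3 z hz).trans (by simp)
  · exact (hB4 z hz).trans (by simp)

theorem exp_bound {M c r l : ℝ} (hc : 0 < c) (hr : 0 < r) (hl : 0 < |l|) (h : c * r * |l| ≤ M) :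
    4 / M ^ 2 ≤ 4 / c ^ 2 * (r ^ 2 * l ^ 2)⁻¹ := by
  have h0 : 0 < c * r * |l| := by positivity
  have e : 4 / c ^ 2 * (r ^ 2 * l ^ 2)⁻¹ = 4 / (c * r * |l|) ^ 2 := by
    rw [← sq_abs l]; field_simp
  rw [e]
  gcongr


theorem area_finite {m : ℕ} {q α β : Fin m → ℝ} (hq : StrictMono q)
    (hα : ∀ i, α i ≤ 1 / 2) (hβ : ∑ i, β i = 0) (hαβ : ∑ i, (α i + q i * β i) ≤ 1 / 2)
    {y1 y2 z1 z2 : ℂ → ℂ}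
    (h1 : ∀ z ∈ slitD m q, HasDerivAt y1 (z1 z) z) (h2 : ∀ z ∈ slitD m q, HasDerivAt y2 (z2 z) z)
    (h3 : ∀ z ∈ slitD m q, HasDerivAt z1 (-(Qf m q α β z / 2) * y1 z) z)
    (h4 : ∀ z ∈ slitD m q, HasDerivAt z2 (-(Qf m q α β z / 2) * y2 z) z)
    (hW : ∀ z ∈ slitD m q, y1 z * z2 z - y2 z * z1 z = 1) :
    IntegrableOn (fun z => Real.exp (vf y1 y2 z)) {z : ℂ | 0 < z.im} := by
  have c1 : ContinuousOn y1 (slitD m q) := fun z hz => (h1 z hz).continuousAt.continuousWithinAt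
  have c2 : ContinuousOn y2 (slitD m q) := fun z hz => (h2 z hz).continuousAt.continuousWithinAt
  have c3 : ContinuousOn z1 (slitD m q) := fun z hz => (h3 z hz).continuousAt.continuousWithinAt
  have c4 : ContinuousOn z2 (slitD m q) := fun z hz => (h4 z hz).continuousAt.continuousWithinAt
  have hclosed : IsClosed {z : ℂ | 0 ≤ z.im} := isClosed_le continuous_const Complex.continuous_im
  have hopen : IsOpen {z : ℂ | 0 < z.im} := isOpen_lt continuous_const Complex.continuous_im
  -- growth at infinity
  have ginf : ∃ R > 1, ∃ c > 0, ∀ z : ℂ, R ≤ ‖z‖ → 0 < z.im →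
      c * ‖z‖ * Real.log ‖z‖ ≤ normSq (y1 z) + normSq (y2 z) := by
    obtain ⟨C, hC⟩ := Qf_inf m q α β hβ
    have hs0 : 0 ≤ ∑ i, |q i| := Finset.sum_nonneg fun i _ => abs_nonneg _
    refine half_plane_growth (Q := Qf m q α β) (fun z hz => h1 z (slitD_H hz)) (fun z hz => h2 z (slitD_H hz))
      (fun z hz => h3 z (slitD_H hz)) (fun z hz => h4 z (slitD_H hz)) (fun z hz => hW z (slitD_H hz))
      (∑ i, (α i + q i * β i)) C (2 * ∑ i, |q i| + 1) (by positivity) hαβ (fun z hz _ => hC z hz) ?_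
    intro R hR
    have hK : IsCompact (Metric.sphere (0:ℂ) R ∩ {z : ℂ | 0 ≤ z.im}) :=
      (isCompact_sphere _ _).inter_right hclosed
    obtain ⟨B, hB⟩ := bound4 hK (fun z hz => slitD_upper hz.2 (fun i hi => by
      have e := mem_sphere_zero_iff_norm.1 hz.1
      rw [hi, Complex.norm_real, Real.norm_eq_abs] at e
      have := Finset.single_le_sum (f := fun i => |q i|) (fun i _ => abs_nonneg _) (Finset.mem_univ i)
      linarith [abs_nonneg (q i)])) c1 c2 c3 c4
    exact ⟨B, fun z hz hzi => hB z ⟨mem_sphere_zero_iff_norm.2 hz, hzi.le⟩⟩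
  have gloc : ∀ i, ∃ R > 1, ∃ c > 0, ∀ z : ℂ, ‖z - q i‖ ≤ R⁻¹ → 0 < z.im →
      c * ‖z - q i‖ * |Real.log ‖z - q i‖| ≤ normSq (y1 z) + normSq (y2 z) := by
    intro i
    obtain ⟨δ, hδ, hsep⟩ := exists_sep m q hq i
    obtain ⟨C, hC⟩ := Qf_loc m q α β i δ hδ hsep
    refine local_growth (Q := Qf m q α β) (fun z hz => h1 z (slitD_H hz)) (fun z hz => h2 z (slitD_H hz))
      (fun z hz => h3 z (slitD_H hz)) (fun z hz => h4 z (slitD_H hz)) (fun z hz => hW z (slitD_H hz))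
      (q i) (α i) C δ hδ (hα i) hC ?_
    intro r hr hrδ
    have hK : IsCompact (Metric.sphere (q i:ℂ) r ∩ {z : ℂ | 0 ≤ z.im}) :=
      (isCompact_sphere _ _).inter_right hclosed
    obtain ⟨B, hB⟩ := bound4 hK (fun z hz => slitD_upper hz.2 (fun j hj => by
      have e := mem_sphere_iff_norm.1 hz.1
      by_cases hji : j = i
      · rw [hj, hji] at e; simp at e; linarith
      · have := sep_norm hsep (e.le.trans hrδ) j hji
        rw [hj] at this; simp at this; linarith)) c1 c2 c3 c4
    exact ⟨B, fun z hz hzi => hB z ⟨mem_sphere_iff_norm.2 hz, hzi.le⟩⟩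
  obtain ⟨R, hR, c, hc, hinf⟩ := ginf
  choose r hr d hd hloc using gloc
  have hcont : ContinuousOn (fun z => Real.exp (vf y1 y2 z)) (slitD m q) :=
    (vf_contDiff (slitD_open m q) h1 h2 hW).continuousOn.rexp
  have i1 : IntegrableOn (fun z => Real.exp (vf y1 y2 z)) ({z : ℂ | 0 < z.im} ∩ {z | R ≤ ‖z‖}) := by
    have hm : MeasurableSet ({z : ℂ | 0 < z.im} ∩ {z | R ≤ ‖z‖}) :=
      hopen.measurableSet.inter (isClosed_le continuous_const continuous_norm).measurableSet
    refine Integrable.mono' ((((int_inf hR).mono_set inter_subset_right).const_mul (4 / c ^ 2)))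
      ((hcont.mono fun z hz => slitD_H hz.1).aestronglyMeasurable hm) ?_
    refine (ae_restrict_iff' hm).2 (Eventually.of_forall fun z hz => ?_)
    have hz1 : 0 < z.im := hz.1
    have hz2 : R ≤ ‖z‖ := hz.2
    rw [Real.norm_eq_abs, Real.abs_exp, vf_exp (Mf_pos (hW z (slitD_H hz1)))]
    have hl : 0 < Real.log ‖z‖ := Real.log_pos (by linarith)
    refine exp_bound hc (by linarith) (abs_pos.2 hl.ne') ?_
    rw [abs_of_pos hl]
    exact hinf z hz2 hz1
  have i2 : ∀ i, IntegrableOn (fun z => Real.exp (vf y1 y2 z)) ({z : ℂ | 0 < z.im} ∩ {z | ‖z - q i‖ ≤ (r i)⁻¹}) := by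
    intro i
    have hm : MeasurableSet ({z : ℂ | 0 < z.im} ∩ {z | ‖z - q i‖ ≤ (r i)⁻¹}) :=
      hopen.measurableSet.inter (isClosed_le (by fun_prop) continuous_const).measurableSet
    have hint : IntegrableOn (fun z : ℂ => (‖z - q i‖ ^ 2 * Real.log ‖z - q i‖ ^ 2)⁻¹) {z | ‖z - q i‖ ≤ (r i)⁻¹} :=
      ((measurePreserving_sub_right volume (q i : ℂ)).integrableOn_comp_preimage
        (measurableEmbedding_subRight _)).2 (int_zero (hr i))
    refine Integrable.mono' ((hint.mono_set inter_subset_right).const_mul (4 / d i ^ 2))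
      ((hcont.mono fun z hz => slitD_H hz.1).aestronglyMeasurable hm) ?_
    refine (ae_restrict_iff' hm).2 (Eventually.of_forall fun z hz => ?_)
    have hz1 : 0 < z.im := hz.1
    have hz2 : ‖z - q i‖ ≤ (r i)⁻¹ := hz.2
    rw [Real.norm_eq_abs, Real.abs_exp, vf_exp (Mf_pos (hW z (slitD_H hz1)))]
    have hp : 0 < ‖z - q i‖ := norm_pos_iff.2 (slitD_ne (slitD_H hz1) i)
    have hl : Real.log ‖z - q i‖ < 0 := Real.log_neg hp (hz2.trans_lt (inv_lt_one_of_one_lt₀ (hr i)))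
    exact exp_bound (hd i) hp (abs_pos.2 hl.ne) (hloc i z hz2 hz1)
  have i3 : IntegrableOn (fun z => Real.exp (vf y1 y2 z))
      (Metric.closedBall (0:ℂ) R ∩ ({z : ℂ | 0 ≤ z.im} ∩ ⋂ i, {z : ℂ | (r i)⁻¹ ≤ ‖z - q i‖})) := by
    refine ContinuousOn.integrableOn_compact ?_ (hcont.mono ?_)
    · exact (isCompact_closedBall _ _).inter_right (hclosed.inter (isClosed_iInter fun i =>
        isClosed_le continuous_const (by fun_prop)))
    · rintro z ⟨_, hz1, hz2⟩
      refine slitD_upper hz1 fun i hi => ?_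
      have h5 : (r i)⁻¹ ≤ ‖z - q i‖ := mem_iInter.1 hz2 i
      rw [hi] at h5
      simp at h5
      linarith [hr i]
  refine ((i1.union (integrableOn_finite_iUnion.2 i2)).union i3).mono_set ?_
  intro z hz
  by_cases hz1 : R ≤ ‖z‖
  · exact Or.inl (Or.inl ⟨hz, hz1⟩)
  by_cases hz2 : ∃ i, ‖z - q i‖ ≤ (r i)⁻¹
  · obtain ⟨i, hi⟩ := hz2
    exact Or.inl (Or.inr (mem_iUnion.2 ⟨i, hz, hi⟩))
  · push Not at hz1 hz2
    have hz' : 0 < z.im := hz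
    exact Or.inr ⟨mem_closedBall_zero_iff.2 hz1.le, hz'.le, mem_iInter.2 fun i => (hz2 i).le⟩

theorem wronsk_const {m : ℕ} {q α β : Fin m → ℝ} {y1 y2 z1 z2 : ℂ → ℂ}
    (h1 : ∀ z ∈ slitD m q, HasDerivAt y1 (z1 z) z) (h2 : ∀ z ∈ slitD m q, HasDerivAt y2 (z2 z) z)
    (h3 : ∀ z ∈ slitD m q, HasDerivAt z1 (-(Qf m q α β z / 2) * y1 z) z)
    (h4 : ∀ z ∈ slitD m q, HasDerivAt z2 (-(Qf m q α β z / 2) * y2 z) z)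
    (hI : y1 I * z2 I - y2 I * z1 I = 1) :
    ∀ z ∈ slitD m q, y1 z * z2 z - y2 z * z1 z = 1 := by
  have hd : ∀ z ∈ slitD m q, HasDerivAt (fun z => y1 z * z2 z - y2 z * z1 z) 0 z := by
    intro z hz
    refine (((h1 z hz).mul (h4 z hz)).sub ((h2 z hz).mul (h3 z hz))).congr_deriv ?_
    ring
  intro z hz
  rw [← hI]
  exact (slitD_open m q).is_const_of_deriv_eq_zero (slitD_preconn m q)
    (f := fun z => y1 z * z2 z - y2 z * z1 z)
    (fun w hw => (hd w hw).differentiableAt.differentiableWithinAt)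
    (fun w hw => (hd w hw).deriv) hz (slitD_H (by simp))

theorem bdry_const {m : ℕ} {q α β : Fin m → ℝ} {y1 y2 z1 z2 : ℂ → ℂ}
    (h1 : ∀ z ∈ slitD m q, HasDerivAt y1 (z1 z) z) (h2 : ∀ z ∈ slitD m q, HasDerivAt y2 (z2 z) z)
    (h3 : ∀ z ∈ slitD m q, HasDerivAt z1 (-(Qf m q α β z / 2) * y1 z) z)
    (h4 : ∀ z ∈ slitD m q, HasDerivAt z2 (-(Qf m q α β z / 2) * y2 z) z)
    {s t : ℝ} (hst : ∀ x ∈ uIcc s t, (x : ℂ) ∈ slitD m q) :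
    (Gf y1 y2 z1 z2 s).im = (Gf y1 y2 z1 z2 t).im := by
  have hd : ∀ x ∈ uIcc s t, HasDerivAt (fun s : ℝ => (Gf y1 y2 z1 z2 s).im) 0 x := by
    intro x hx
    have hD := hst x hx
    refine Gf_im_deriv (k := fun z => -(Qf m q α β z / 2)) (h1 _ hD) (h2 _ hD) (h3 _ hD) (h4 _ hD) ?_
    have := Qf_real m q α β x
    simp [this]
  have := (convex_uIcc s t).norm_image_sub_le_of_norm_hasDerivWithin_le
    (f := fun s : ℝ => (Gf y1 y2 z1 z2 s).im) (f' := fun _ => 0) (C := 0)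
    (fun x hx => (hd x hx).hasDerivWithinAt) (fun x _ => by simp) right_mem_uIcc left_mem_uIcc
  simp only [zero_mul, norm_le_zero_iff] at this
  exact sub_eq_zero.1 this


/-- conversely, for any q₁ < ⋯ < q_m and αᵢ, βᵢ ∈ ℝ with αᵢ ≤ 1/2,
Σ βᵢ = 0 and Σ (αᵢ + qᵢ βᵢ) ≤ 1/2, there exists a finite-area solution of problem (+s)
with K = 1 (for some boundary constants c_j) whose Schwarzian map is
Q(z) = Σᵢ ( αᵢ/(z−qᵢ)² + βᵢ/(z−qᵢ) ). -/
theorem polygonal_solution_with_given_schwarzian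
    (m : ℕ) (q : Fin m → ℝ) (hq : StrictMono q)
    (α β : Fin m → ℝ)
    (hα : ∀ i, α i ≤ 1 / 2)
    (hβ : ∑ i, β i = 0)
    (hαβ : ∑ i, (α i + q i * β i) ≤ 1 / 2) :
    ∃ (c : Fin (m + 1) → ℝ) (v : ℂ → ℝ),
      IsSolutionPS 1 m q c v ∧
      IntegrableOn (fun z => Real.exp (v z)) {z : ℂ | 0 < z.im} ∧
      ∀ z : ℂ, 0 < z.im →
        schwarzianMap v z =
          ∑ i, (((α i : ℝ) : ℂ) / (z - (q i : ℂ)) ^ 2 +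
            ((β i : ℝ) : ℂ) / (z - (q i : ℂ))) := by
  classical
  have hQd : DifferentiableOn ℂ (fun z => -(Qf m q α β z / 2)) (slitD m q) :=
    ((Qf_diff m q α β).div_const 2).neg
  have hI : I ∈ slitD m q := slitD_H (by simp)
  obtain ⟨y1, z1, h1, h3, a1, b1⟩ := ode_exists (slitD_open m q) hI (slitD_star m q) hQd 1 0
  obtain ⟨y2, z2, h2, h4, a2, b2⟩ := ode_exists (slitD_open m q) hI (slitD_star m q) hQd 0 1
  have hW := wronsk_const (α := α) (β := β) h1 h2 h3 h4 (by rw [a1, b1, a2, b2]; simp)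
  let P : Fin (m + 1) → ℝ → Prop := fun j s =>
    ∀ i : Fin m, ((i : ℕ) < (j : ℕ) → q i < s) ∧ ((j : ℕ) ≤ (i : ℕ) → s < q i)
  have hPD : ∀ j s, P j s → (s : ℂ) ∈ slitD m q := by
    intro j s hs
    refine slitD_upper (by simp) fun i hi => ?_
    have e : s = q i := by exact_mod_cast hi
    rcases lt_or_ge (i : ℕ) (j : ℕ) with h | h
    · exact absurd e ((hs i).1 h).ne'
    · exact absurd e ((hs i).2 h).ne
  have hPc : ∀ j s t, P j s → P j t → ∀ x ∈ uIcc s t, P j x := by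
    intro j s t hs ht x hx i
    refine ⟨fun h => ?_, fun h => ?_⟩
    · have := hx.1
      exact (lt_inf_iff.2 ⟨(hs i).1 h, (ht i).1 h⟩).trans_le hx.1
    · exact hx.2.trans_lt (sup_lt_iff.2 ⟨(hs i).2 h, (ht i).2 h⟩)
  refine ⟨fun j => if h : ∃ s, P j s then 2 * (Gf y1 y2 z1 z2 (h.choose : ℝ)).im else 0, vf y1 y2,
    ⟨?_, ?_, ?_⟩, ?_, ?_⟩
  · refine (vf_contDiff (slitD_open m q) h1 h2 hW).mono ?_
    rintro z ⟨hz, hz2⟩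
    exact slitD_upper hz fun i hi => hz2 ⟨i, hi.symm⟩
  · intro z hz
    exact vf_lap (slitD_open m q) h1 h2 h3 h4 hW (slitD_H hz)
  · intro j s hs
    have hs' : P j s := hs
    have hD := hPD j s hs'
    have hex : ∃ s, P j s := ⟨s, hs'⟩
    rw [vf_dnu (h1 _ hD) (h2 _ hD) (hW _ hD)]
    beta_reduce
    rw [dif_pos hex,
      bdry_const (α := α) (β := β) h1 h2 h3 h4
        (fun x hx => hPD j x (hPc j s hex.choose hs' hex.choose_spec x hx))]
  · exact area_finite hq hα hβ hαβ h1 h2 h3 h4 hW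
  · intro z hz
    rw [vf_schwarz (slitD_open m q) h1 h2 h3 h4 hW (slitD_H hz) hz]
    change -2 * -(Qf m q α β z / 2) = Qf m q α β z
    ring
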